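/- Discrete trace inequality: Let T ∈ T_ℓ be a triangle, let 𝒦 be a regular triangulation of T, and let G be an edge of T. Then any function f that is piecewise smooth with respect to 𝒦 satisfies ‖f‖_{L²(G)} ≲ h_T^{-1/2}‖f‖_{L²(T)} + h_T^{1/2}‖D_{NC(𝒦)} f‖_{L²(T)} + h_T^{1/2}·( Σ_{F ∈ 𝔽(𝒦), F ⊄ ∂T} h_F^{-1}‖[f]_F‖²_{L²(F)} )^{1/2}, where the generic constant depends only on Ω and the initial triangulation T₀ (in particular the ratio h_T/h_F need not be uniformly bounded). -/

import Mathlib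

open MeasureTheory
open scoped ENNReal RealInnerProductSpace Classical

noncomputable section

/-- Points of the plane. -/
abbrev E2 : Type := EuclideanSpace ℝ (Fin 2)

/-- The closed triangle spanned by three points (a triangle is recorded by
its vertex triple). -/
def tri (v : Fin 3 → E2) : Set E2 := convexHull ℝ (Set.range v)

/-- `𝒦` is a regular triangulation of the set `S`: the triangles are
nondegenerate, they cover `S`, and any two distinct triangles are either
disjoint or share exactly one common vertex or exactly one common edge. -/
def IsRegularTriangulationOf (𝒦 : Finset (Fin 3 → E2)) (S : Set E2) : Prop :=
  (∀ K ∈ 𝒦, AffineIndependent ℝ K) ∧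
  (⋃ K ∈ 𝒦, tri K) = S ∧
  (∀ K ∈ 𝒦, ∀ K' ∈ 𝒦, K ≠ K' →
    tri K ∩ tri K' = ∅ ∨
    (∃ i, tri K ∩ tri K' = {K i}) ∨
    (∃ i i', i ≠ i' ∧ tri K ∩ tri K' = segment ℝ (K i) (K i')))

/-- Shape regularity with parameter `γ`: `diam(K)² ≤ γ · |K|`, i.e. the
diameter is comparable with the mesh-size `h_K = |K|^{1/2}`.  (For the
admissible class `𝕋` of newest-vertex bisection refinements of `T₀` such a
bound holds uniformly, with `γ` depending only on `T₀`.) -/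
def ShapeReg (γ : ℝ) (v : Fin 3 → E2) : Prop :=
  (Metric.diam (tri v)) ^ 2 ≤ γ * (volume (tri v)).toReal

/-- The mesh-size `h_T = |T|^{1/2}` of a triangle. -/
def hT (v : Fin 3 → E2) : ℝ := Real.sqrt ((volume (tri v)).toReal)

/-- The contribution `h_F⁻¹ ‖[f]_F‖²_{L²(F)}` of the interior edge
`F = K ∩ K'` (an edge of the triangulation of `T = tri Tv` not contained in
`∂T`) to the jump term; `0` if `K, K'` do not share an interior edge.  The
jump of the piecewise smooth function `f` (given by its smooth pieces
`f K`) across `F` is `f K - f K'`. -/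
def jumpTerm (Tv : Fin 3 → E2) (K K' : Fin 3 → E2)
    (f : (Fin 3 → E2) → E2 → ℝ) : ℝ :=
  if K ≠ K' ∧ 0 < μH[1] (tri K ∩ tri K') ∧
      ¬ tri K ∩ tri K' ⊆ frontier (tri Tv) then
    (Metric.diam (tri K ∩ tri K'))⁻¹ *
      ∫ x in tri K ∩ tri K', (f K x - f K' x) ^ 2 ∂μH[1]
  else 0

/-- Twice the signed area of the triangle `p q r`. -/
def cross (p q r : E2) : ℝ := (q 0 - p 0) * (r 1 - p 1) - (q 1 - p 1) * (r 0 - p 0)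

/-- The barycentric coordinate of `x` with respect to the vertex `i` of the triangle `v`. -/
def bary (v : Fin 3 → E2) (i : Fin 3) (x : E2) : ℝ :=
  cross (v (i + 1)) (v (i + 2)) x / cross (v 0) (v 1) (v 2)

/-- The edge of the triangle `v` opposite to the vertex `i`. -/
def oppEdge (v : Fin 3 → E2) (i : Fin 3) : Set E2 := segment ℝ (v (i + 1)) (v (i + 2))

lemma fin_three_one_add_two : (1 : Fin 3) + 2 = 0 := rfl

lemma fin_three_two_add_two : (2 : Fin 3) + 2 = 1 := rfl

lemma fin_three_one_add_one : (1 : Fin 3) + 1 = 2 := rfl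

lemma fin_three_two_add_one : (2 : Fin 3) + 1 = 0 := rfl

lemma E2.ext_coord {x y : E2} (h0 : x 0 = y 0) (h1 : x 1 = y 1) : x = y := by
  ext c
  fin_cases c
  · exact h0
  · exact h1

lemma cross_rotate (v : Fin 3 → E2) (i : Fin 3) :
    cross (v (i + 1)) (v (i + 2)) (v i) = cross (v 0) (v 1) (v 2) := by
  fin_cases i <;>
    simp [cross, fin_three_one_add_two, fin_three_two_add_two, fin_three_one_add_one,
      fin_three_two_add_one] <;> ring

lemma cross_lineMap (p q x y : E2) (t : ℝ) :
    cross p q (AffineMap.lineMap x y t) = (1 - t) * cross p q x + t * cross p q y := by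
  simp [cross, AffineMap.lineMap_apply]
  ring

lemma continuous_cross (p q : E2) : Continuous (cross p q) := by
  unfold cross
  fun_prop

lemma cross_ne_zero {v : Fin 3 → E2} (hv : AffineIndependent ℝ v) :
    cross (v 0) (v 1) (v 2) ≠ 0 := by
  intro h
  have key : ∀ z : E2, cross (v 1) (v 2) z = 0 := by
    intro z
    have := (affineIndependent_iff.1 hv) Finset.univ
      (fun i => cross (v (i + 1)) (v (i + 2)) z) ?_ ?_ 0 (Finset.mem_univ _)
    · simpa using this
    · simp only [Fin.sum_univ_three, fin_three_one_add_two, fin_three_two_add_two,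
        fin_three_one_add_one, fin_three_two_add_one, zero_add]
      unfold cross at *
      linear_combination h
    · simp only [Fin.sum_univ_three, fin_three_one_add_two, fin_three_two_add_two,
        fin_three_one_add_one, fin_three_two_add_one, zero_add]
      apply E2.ext_coord
      · simp only [PiLp.add_apply, PiLp.smul_apply, smul_eq_mul, PiLp.zero_apply]
        unfold cross at *
        linear_combination z 0 * h
      · simp only [PiLp.add_apply, PiLp.smul_apply, smul_eq_mul, PiLp.zero_apply]
        unfold cross at *
        linear_combination z 1 * h
  have h0 := key !₂[v 1 0 + 1, v 1 1]
  have h1 := key !₂[v 1 0, v 1 1 + 1]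
  simp [cross] at h0 h1
  have : v 1 = v 2 := E2.ext_coord (by linarith) (by linarith)
  have := hv.injective this
  simp at this

lemma sum_bary {v : Fin 3 → E2} (hv : AffineIndependent ℝ v) (x : E2) :
    bary v 0 x + bary v 1 x + bary v 2 x = 1 := by
  have h := cross_ne_zero hv
  simp only [bary, fin_three_one_add_two, fin_three_two_add_two, fin_three_one_add_one,
    fin_three_two_add_one, zero_add]
  field_simp
  unfold cross
  ring

lemma sum_bary_smul {v : Fin 3 → E2} (hv : AffineIndependent ℝ v) (x : E2) :
    bary v 0 x • v 0 + bary v 1 x • v 1 + bary v 2 x • v 2 = x := by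
  have h := cross_ne_zero hv
  simp only [bary, fin_three_one_add_two, fin_three_two_add_two, fin_three_one_add_one,
    fin_three_two_add_one, zero_add]
  apply E2.ext_coord <;>
  · simp only [PiLp.add_apply, PiLp.smul_apply, smul_eq_mul]
    field_simp
    unfold cross
    ring

lemma bary_lineMap (v : Fin 3 → E2) (i : Fin 3) (x y : E2) (t : ℝ) :
    bary v i (AffineMap.lineMap x y t) = (1 - t) * bary v i x + t * bary v i y := by
  simp only [bary, cross_lineMap]
  ring

lemma continuous_bary (v : Fin 3 → E2) (i : Fin 3) : Continuous (bary v i) :=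
  (continuous_cross _ _).div_const _

lemma bary_self {v : Fin 3 → E2} (hv : AffineIndependent ℝ v) (i : Fin 3) :
    bary v i (v i) = 1 := by
  rw [bary, cross_rotate, div_self (cross_ne_zero hv)]

lemma bary_add_one (v : Fin 3 → E2) (i : Fin 3) : bary v i (v (i + 1)) = 0 := by
  simp [bary, cross]

lemma bary_add_two (v : Fin 3 → E2) (i : Fin 3) : bary v i (v (i + 2)) = 0 := by
  simp [bary, cross]
  left
  ring

lemma bary_of_ne (v : Fin 3 → E2) {i j : Fin 3} (h : j ≠ i) : bary v i (v j) = 0 := by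
  have : j = i + 1 ∨ j = i + 2 := by revert i j; decide
  rcases this with rfl | rfl
  · exact bary_add_one v i
  · exact bary_add_two v i

lemma mem_tri_iff {v : Fin 3 → E2} (hv : AffineIndependent ℝ v) {x : E2} :
    x ∈ tri v ↔ ∀ i, 0 ≤ bary v i x := by
  constructor
  · intro hx i
    have hc : Convex ℝ {y | 0 ≤ bary v i y} := by
      intro y hy z hz a b ha hb hab
      have : a • y + b • z = AffineMap.lineMap y z b := by
        rw [AffineMap.lineMap_apply_module, ← hab]; simp
      simp only [Set.mem_ofPred_eq] at *
      rw [this, bary_lineMap]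
      have : 0 ≤ 1 - b := by linarith
      positivity
    refine convexHull_min ?_ hc hx
    rintro _ ⟨j, rfl⟩
    by_cases h : j = i
    · subst h; simp [bary_self hv]
    · simp [bary_of_ne v h]
  · intro h
    rw [← sum_bary_smul hv x]
    have hm : ∀ j, v j ∈ tri v := fun j => subset_convexHull ℝ _ ⟨j, rfl⟩
    have := (convex_convexHull ℝ (Set.range v)).sum_mem (t := Finset.univ)
      (w := fun i => bary v i x) (z := v) (fun i _ => h i)
      (by simpa [Fin.sum_univ_three] using sum_bary hv x) (fun i _ => hm i)
    simpa [tri, Fin.sum_univ_three] using this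

lemma vertex_mem_tri (v : Fin 3 → E2) (i : Fin 3) : v i ∈ tri v :=
  subset_convexHull ℝ _ ⟨i, rfl⟩

lemma convex_tri (v : Fin 3 → E2) : Convex ℝ (tri v) := convex_convexHull ℝ _

lemma isCompact_tri (v : Fin 3 → E2) : IsCompact (tri v) :=
  (Set.finite_range v).isCompact_convexHull ℝ

lemma oppEdge_subset_tri (v : Fin 3 → E2) (i : Fin 3) : oppEdge v i ⊆ tri v :=
  (convex_tri v).segment_subset (vertex_mem_tri v _) (vertex_mem_tri v _)

lemma mem_oppEdge_iff {v : Fin 3 → E2} (hv : AffineIndependent ℝ v) {i : Fin 3} {x : E2} :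
    x ∈ oppEdge v i ↔ x ∈ tri v ∧ bary v i x = 0 := by
  constructor
  · intro hx
    refine ⟨oppEdge_subset_tri v i hx, ?_⟩
    rw [oppEdge, segment_eq_image_lineMap] at hx
    obtain ⟨t, -, rfl⟩ := hx
    rw [bary_lineMap, bary_add_one, bary_add_two]
    ring
  · rintro ⟨hx, h0⟩
    rw [mem_tri_iff hv] at hx
    refine ⟨bary v (i + 1) x, bary v (i + 2) x, hx _, hx _, ?_, ?_⟩
    · have := sum_bary hv x
      fin_cases i <;> simp [fin_three_one_add_two, fin_three_two_add_two, fin_three_one_add_one,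
        fin_three_two_add_one] at * <;> linarith
    · conv_rhs => rw [← sum_bary_smul hv x]
      fin_cases i <;> simp [fin_three_one_add_two, fin_three_two_add_two, fin_three_one_add_one,
        fin_three_two_add_one] at * <;> simp [h0, add_comm]

lemma setIntegral_segment (p q : E2) (g : E2 → ℝ) :
    ∫ x in segment ℝ p q, g x ∂μH[1] =
      ‖q - p‖ * ∫ t in (0 : ℝ)..1, g (AffineMap.lineMap p q t) := by
  have : NullSingletonClass (μH[1] : Measure E2) :=
    Measure.nullSingletonClass_hausdorff E2 one_pos
  by_cases hpq : p = q
  · subst hpq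
    simp
  have hL : 0 < ‖q - p‖ := norm_pos_iff.2 (sub_ne_zero.2 (Ne.symm hpq))
  set L := ‖q - p‖ with hLdef
  set ι : ℝ → E2 := fun s => p + (s / L) • (q - p) with hι
  have hiso : Isometry ι := by
    refine Isometry.of_dist_eq fun s t => ?_
    have h : ι s - ι t = ((s - t) / L) • (q - p) := by
      simp only [hι]
      module
    rw [dist_eq_norm, h, norm_smul, norm_div, Real.norm_of_nonneg hL.le, ← hLdef, ← dist_eq_norm]
    field_simp
  have himg : segment ℝ p q ⊆ Set.range ι := by
    rw [segment_eq_image']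
    rintro _ ⟨t, -, rfl⟩
    refine ⟨t * L, ?_⟩
    simp only [hι]
    rw [mul_div_cancel_right₀ _ hL.ne']
  have hpre : ι ⁻¹' segment ℝ p q = Set.Icc 0 L := by
    ext s
    simp only [Set.mem_preimage, segment_eq_image', Set.mem_image]
    constructor
    · rintro ⟨t, ⟨h0, h1⟩, h⟩
      have h2 : ι (t * L) = ι s := by
        rw [← h]; simp only [hι]; rw [mul_div_cancel_right₀ _ hL.ne']
      rw [← hiso.injective h2]
      constructor <;> nlinarith
    · rintro ⟨h0, h1⟩
      exact ⟨s / L, ⟨by positivity, by rw [div_le_one hL]; exact h1⟩, rfl⟩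
  have hmap := hiso.map_hausdorffMeasure (d := 1) (Or.inl zero_le_one)
  have hseg : MeasurableSet (segment ℝ p q) := by
    rw [segment_eq_image']
    exact (isCompact_Icc.image (by fun_prop)).measurableSet
  have h1 : ∫ x in segment ℝ p q, g x ∂μH[1] =
      ∫ x in segment ℝ p q, g x ∂(Measure.map ι μH[1]) := by
    rw [hmap, Measure.restrict_restrict hseg, Set.inter_eq_left.2 himg]
  rw [h1, hiso.isClosedEmbedding.measurableEmbedding.setIntegral_map, hpre, hausdorffMeasure_real,
    integral_Icc_eq_integral_Ioc, ← intervalIntegral.integral_of_le hL.le]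
  have h2 := intervalIntegral.integral_comp_mul_left (a := 0) (b := 1)
    (fun s => g (ι s)) hL.ne'
  simp only [mul_zero, mul_one, smul_eq_mul] at h2
  have h3 : ∀ t : ℝ, ι (L * t) = AffineMap.lineMap p q t := by
    intro t
    simp only [hι, AffineMap.lineMap_apply_module']
    rw [mul_div_cancel_left₀ _ hL.ne', add_comm]
  simp only [h3] at h2
  rw [h2]
  field_simp

lemma measurableSet_segment (p q : E2) : MeasurableSet (segment ℝ p q) := by
  rw [segment_eq_image']
  exact (isCompact_Icc.image (by fun_prop)).measurableSet

lemma hausdorffMeasure_segment_pos {p q : E2} (h : p ≠ q) : 0 < μH[1] (segment ℝ p q) := by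
  have h1 := setIntegral_segment p q (fun _ => 1)
  simp at h1
  rw [pos_iff_ne_zero]
  intro h0
  rw [Measure.real, h0] at h1
  simp at h1
  exact h (sub_eq_zero.1 (norm_eq_zero.1 h1.symm)).symm

lemma hausdorffMeasure_segment_lt_top (p q : E2) : μH[1] (segment ℝ p q) < ⊤ := by
  by_cases h : p = q
  · have : NullSingletonClass (μH[1] : Measure E2) :=
      Measure.nullSingletonClass_hausdorff E2 one_pos
    subst h
    simp
  have h1 := setIntegral_segment p q (fun _ => 1)
  simp at h1
  rw [lt_top_iff_ne_top]
  intro h0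
  rw [Measure.real, h0] at h1
  simp at h1
  exact h (sub_eq_zero.1 (norm_eq_zero.1 h1.symm)).symm

lemma integrableOn_segment {p q : E2} {g : E2 → ℝ} (hg : Continuous g) :
    IntegrableOn g (segment ℝ p q) μH[1] := by
  have hc : IsCompact (segment ℝ p q) := by
    rw [segment_eq_image']
    exact isCompact_Icc.image (by fun_prop)
  exact hg.continuousOn.integrableOn_of_subset_isCompact hc (measurableSet_segment p q)
    subset_rfl (hausdorffMeasure_segment_lt_top p q).ne

/-- The plane as a product, with its measure. -/
def planeEquiv : E2 ≃ᵐ ℝ × ℝ :=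
  (MeasurableEquiv.toLp 2 (Fin 2 → ℝ)).symm.trans MeasurableEquiv.finTwoArrow

lemma measurePreserving_planeEquiv : MeasurePreserving planeEquiv volume volume :=
  (EuclideanSpace.volume_preserving_symm_measurableEquiv_toLp (Fin 2)).trans
    (volume_preserving_finTwoArrow ℝ)

/-- Collapsed coordinates on the triangle with vertices `a, b, c`, centred at `a`. -/
def duffy (a b c : E2) (z : ℝ × ℝ) : E2 :=
  AffineMap.lineMap a (AffineMap.lineMap b c z.1 : E2) z.2

lemma duffy_apply (a b c : E2) (z : ℝ × ℝ) (k : Fin 2) :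
    duffy a b c z k = a k + z.2 * (b k - a k) + z.2 * z.1 * (c k - b k) := by
  simp [duffy, AffineMap.lineMap_apply]
  ring

lemma continuous_duffy (a b c : E2) : Continuous (duffy a b c) := by
  unfold duffy
  simp only [AffineMap.lineMap_apply_module']
  fun_prop

lemma setIntegral_tri_eq_duffy {v : Fin 3 → E2} (hv : AffineIndependent ℝ v) (i : Fin 3)
    (g : E2 → ℝ) :
    ∫ x in tri v, g x = |cross (v 0) (v 1) (v 2)| *
      ∫ z in Set.Icc (0 : ℝ) 1 ×ˢ Set.Ioc (0 : ℝ) 1,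
        z.2 * g (duffy (v i) (v (i + 1)) (v (i + 2)) z) := by
  set a := v i with ha
  set b := v (i + 1) with hb
  set c := v (i + 2) with hc
  set S := Set.Icc (0 : ℝ) 1 ×ˢ Set.Ioc (0 : ℝ) 1 with hS
  have hD0 := cross_ne_zero hv
  have hD : cross b c a = cross (v 0) (v 1) (v 2) := cross_rotate v i
  set D := cross (v 0) (v 1) (v 2)
  have hD' : (b 0 - a 0) * (c 1 - a 1) - (b 1 - a 1) * (c 0 - a 0) = D := by
    rw [← hD]; unfold cross; ring
  have hinj : Set.InjOn (duffy a b c) S := by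
    rintro ⟨t, s⟩ ⟨-, hs⟩ ⟨t', s'⟩ ⟨-, hs'⟩ h
    have e0 := congrArg (fun x : E2 => x 0) h
    have e1 := congrArg (fun x : E2 => x 1) h
    simp only [duffy_apply] at e0 e1
    simp only [Set.mem_Ioc] at hs hs'
    have h1 : (s - s') * D = 0 := by
      rw [← hD']
      linear_combination (c 1 - b 1) * e0 - (c 0 - b 0) * e1
    have h2 : (s * t - s' * t') * D = 0 := by
      rw [← hD']
      linear_combination - (b 1 - a 1) * e0 + (b 0 - a 0) * e1
    have h3 : s = s' := by
      have := (mul_eq_zero.1 h1).resolve_right hD0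
      linarith
    subst h3
    have h4 := (mul_eq_zero.1 h2).resolve_right hD0
    have h5 : s * (t - t') = 0 := by linarith
    have h6 := (mul_eq_zero.1 h5).resolve_left hs.1.ne'
    have : t = t' := by linarith
    rw [this]
  have hbi : ∀ z, bary v i (duffy a b c z) = 1 - z.2 := by
    intro z
    rw [duffy, bary_lineMap, bary_lineMap, hb, hc, bary_add_one, bary_add_two, ha, bary_self hv]
    ring
  have himg : duffy a b c '' S = tri v \ {a} := by
    ext x
    constructor
    · rintro ⟨z, ⟨ht, hs⟩, rfl⟩
      constructor
      · have h1 := (convex_tri v).lineMap_mem (vertex_mem_tri v (i + 1))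
          (vertex_mem_tri v (i + 2)) ht
        exact (convex_tri v).lineMap_mem (vertex_mem_tri v i) h1 ⟨hs.1.le, hs.2⟩
      · intro h
        rw [Set.mem_singleton_iff] at h
        have h1 := hbi z
        rw [h, ha, bary_self hv] at h1
        have := hs.1
        linarith
    · rintro ⟨hx, hxa⟩
      have hnn := (mem_tri_iff hv).1 hx
      have hsum : bary v i x + bary v (i + 1) x + bary v (i + 2) x = 1 := by
        have := sum_bary hv x
        fin_cases i <;> simp [fin_three_one_add_two, fin_three_two_add_two,
          fin_three_one_add_one, fin_three_two_add_one] at * <;> linarith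
      have hrec : bary v i x • a + bary v (i + 1) x • b + bary v (i + 2) x • c = x := by
        have := sum_bary_smul hv x
        rw [ha, hb, hc]
        conv_rhs => rw [← this]
        fin_cases i <;> simp [fin_three_one_add_two, fin_three_two_add_two,
          fin_three_one_add_one, fin_three_two_add_one] <;> abel
      set α := bary v i x
      set β := bary v (i + 1) x
      set δ := bary v (i + 2) x
      have hβ : 0 ≤ β := hnn _
      have hδ : 0 ≤ δ := hnn _
      have hα : 0 ≤ α := hnn _
      have hpos : 0 < β + δ := by
        rcases (add_nonneg hβ hδ).eq_or_lt with h | h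
        · exfalso
          apply hxa
          have h1 : β = 0 := by linarith
          have h2 : δ = 0 := by linarith
          have h3 : α = 1 := by linarith
          rw [Set.mem_singleton_iff, ← hrec, h1, h2, h3]
          simp
        · exact h
      refine ⟨(δ / (β + δ), β + δ), ⟨⟨by positivity, ?_⟩, hpos, by linarith⟩, ?_⟩
      · rw [div_le_one hpos]; linarith
      · rw [← hrec]
        have h3 : α = 1 - β - δ := by linarith
        apply E2.ext_coord <;>
        · simp only [duffy_apply, PiLp.add_apply, PiLp.smul_apply, smul_eq_mul, h3]
          field_simp
          ring
  have hmS : MeasurableSet S := measurableSet_Icc.prod measurableSet_Ioc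
  have h1 : ∫ x in tri v, g x = ∫ x in duffy a b c '' S, g x := by
    rw [himg]
    exact setIntegral_congr_set (sdiff_null_ae_eq_self (by simp)).symm
  have h2 : ∫ x in duffy a b c '' S, g x =
      ∫ z in (fun z => planeEquiv (duffy a b c z)) '' S, g (planeEquiv.symm z) := by
    rw [← measurePreserving_planeEquiv.setIntegral_preimage_emb
      planeEquiv.measurableEmbedding (fun z => g (planeEquiv.symm z))]
    have : planeEquiv ⁻¹' ((fun z => planeEquiv (duffy a b c z)) '' S) = duffy a b c '' S := by
      rw [show (fun z => planeEquiv (duffy a b c z)) = planeEquiv ∘ duffy a b c from rfl,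
        Set.image_comp, planeEquiv.injective.preimage_image]
    simp [this]
  have hder : ∀ z ∈ S, HasFDerivWithinAt (fun z => planeEquiv (duffy a b c z))
      (LinearMap.toContinuousLinearMap (Matrix.toLin (.finTwoProd ℝ) (.finTwoProd ℝ)
        !![z.2 * (c 0 - b 0), (b 0 - a 0) + z.1 * (c 0 - b 0);
           z.2 * (c 1 - b 1), (b 1 - a 1) + z.1 * (c 1 - b 1)])) S z := by
    intro z _
    refine HasFDerivAt.hasFDerivWithinAt ?_
    rw [Matrix.toLin_finTwoProd_toContinuousLinearMap]
    have hk : ∀ k : Fin 2, HasFDerivAt (fun z : ℝ × ℝ => duffy a b c z k)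
        ((z.2 * (c k - b k)) • ContinuousLinearMap.fst ℝ ℝ ℝ +
          ((b k - a k) + z.1 * (c k - b k)) • ContinuousLinearMap.snd ℝ ℝ ℝ) z := by
      intro k
      have h := ((hasFDerivAt_snd (𝕜 := ℝ) (p := z)).mul_const (b k - a k)).const_add (a k) |>.add
        (((hasFDerivAt_snd (𝕜 := ℝ) (p := z)).mul
          (hasFDerivAt_fst (𝕜 := ℝ) (p := z))).mul_const (c k - b k))
      have e : (fun z : ℝ × ℝ => duffy a b c z k) =
          (fun x : ℝ × ℝ => a k + x.2 * (b k - a k)) + fun y => y.2 * y.1 * (c k - b k) := by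
        funext z
        simp [duffy_apply]
      rw [e]
      refine h.congr_fderiv ?_
      ext <;> simp <;> ring
    exact (hk 0).prodMk (hk 1)
  rw [h1, h2, integral_image_eq_integral_abs_det_fderiv_smul volume hmS hder
    (planeEquiv.injective.comp_injOn hinj), ← integral_const_mul]
  refine setIntegral_congr_fun hmS fun z hz => ?_
  simp only [LinearMap.det_toContinuousLinearMap, LinearMap.det_toLin,
    Matrix.det_fin_two_of, MeasurableEquiv.symm_apply_apply, smul_eq_mul]
  have : z.2 * (c 0 - b 0) * (b 1 - a 1 + z.1 * (c 1 - b 1)) -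
      (b 0 - a 0 + z.1 * (c 0 - b 0)) * (z.2 * (c 1 - b 1)) = - (z.2 * D) := by
    rw [← hD']; ring
  rw [this, abs_neg, abs_mul, abs_of_pos hz.2.1]
  ring

/-- The trace identity: divergence theorem for `g (x - a)` on a triangle with vertex `a`. -/
lemma setIntegral_tri_vertex {v : Fin 3 → E2} (hv : AffineIndependent ℝ v) (i : Fin 3)
    {g : E2 → ℝ} (hg : ContDiff ℝ 1 g) :
    ∫ x in tri v, (2 * g x + fderiv ℝ g x (x - v i)) =
      |cross (v 0) (v 1) (v 2)| *
        ∫ t in (0 : ℝ)..1, g (AffineMap.lineMap (v (i + 1)) (v (i + 2)) t) := by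
  rw [setIntegral_tri_eq_duffy hv i]
  congr 1
  set a := v i
  set b := v (i + 1)
  set c := v (i + 2)
  have hg' : Continuous (fderiv ℝ g) := hg.continuous_fderiv one_ne_zero
  have hcont : Continuous (fun z : ℝ × ℝ => z.2 * (2 * g (duffy a b c z) +
      fderiv ℝ g (duffy a b c z) (duffy a b c z - a))) := by
    have := continuous_duffy a b c
    have := hg.continuous
    fun_prop
  rw [Measure.volume_eq_prod, setIntegral_prod, intervalIntegral.integral_of_le zero_le_one,
    integral_Icc_eq_integral_Ioc]
  · refine setIntegral_congr_fun measurableSet_Ioc fun t _ => ?_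
    simp only
    rw [← intervalIntegral.integral_of_le zero_le_one,
      intervalIntegral.integral_eq_sub_of_hasDerivAt
        (f := fun s => s ^ 2 * g (duffy a b c (t, s)))]
    · simp [duffy]
    · intro s _
      have h1 : HasDerivAt (fun s : ℝ => duffy a b c (t, s))
          ((AffineMap.lineMap b c t : E2) - a) s := by
        simp only [duffy]
        exact AffineMap.hasDerivAt_lineMap
      have h2 := ((hg.differentiable one_ne_zero).differentiableAt
        (x := duffy a b c (t, s))).hasFDerivAt.comp_hasDerivAt s h1
      have h3 := (hasDerivAt_pow 2 s).mul h2
      refine h3.congr_deriv ?_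
      have h4 : duffy a b c (t, s) - a = s • ((AffineMap.lineMap b c t : E2) - a) := by
        simp [duffy, AffineMap.lineMap_apply_module']
      rw [h4, map_smul]
      simp [duffy]
      ring
    · exact (hcont.comp (by fun_prop : Continuous fun s : ℝ => (t, s))).intervalIntegrable _ _
  · refine (hcont.continuousOn.integrableOn_compact
      ((isCompact_Icc (a := (0 : ℝ)) (b := 1)).prod
        (isCompact_Icc (a := (0 : ℝ)) (b := 1)))).mono_set ?_
    exact Set.prod_mono subset_rfl Set.Ioc_subset_Icc_self

lemma volume_tri {v : Fin 3 → E2} (hv : AffineIndependent ℝ v) :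
    2 * (volume (tri v)).toReal = |cross (v 0) (v 1) (v 2)| := by
  have := setIntegral_tri_vertex hv 0 (g := fun _ => 1) contDiff_const
  simp at this
  rw [← this, Measure.real]
  ring

lemma integrableOn_tri (v : Fin 3 → E2) {g : E2 → ℝ} (hg : Continuous g) :
    IntegrableOn g (tri v) :=
  hg.continuousOn.integrableOn_compact (isCompact_tri v)

/-- The divergence theorem for `g (x - P)` on a triangle. -/
lemma setIntegral_tri_point {v : Fin 3 → E2} (hv : AffineIndependent ℝ v) (P : E2)
    {g : E2 → ℝ} (hg : ContDiff ℝ 1 g) :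
    ∫ x in tri v, (2 * g x + fderiv ℝ g x (x - P)) =
      ∑ i, |cross (v 0) (v 1) (v 2)| * bary v i P *
        ∫ t in (0 : ℝ)..1, g (AffineMap.lineMap (v (i + 1)) (v (i + 2)) t) := by
  have hg' : Continuous (fderiv ℝ g) := hg.continuous_fderiv one_ne_zero
  have hgc := hg.continuous
  have h : ∀ i, |cross (v 0) (v 1) (v 2)| * bary v i P *
        ∫ t in (0 : ℝ)..1, g (AffineMap.lineMap (v (i + 1)) (v (i + 2)) t) =
      ∫ x in tri v, bary v i P * (2 * g x + fderiv ℝ g x (x - v i)) := by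
    intro i
    rw [integral_const_mul, setIntegral_tri_vertex hv i hg]
    ring
  simp_rw [h]
  rw [← integral_finsetSum]
  · congr 1
    funext x
    simp only [Fin.sum_univ_three]
    have h1 := sum_bary hv P
    have h2 := congrArg (fderiv ℝ g x) (sum_bary_smul hv P)
    simp only [map_add, map_smul, smul_eq_mul, map_sub] at *
    linear_combination h2 - (2 * g x + fderiv ℝ g x x) * h1
  · intro i _
    exact integrableOn_tri v (by fun_prop)

lemma fin_three_eq_of_ne {i k : Fin 3} (h : k ≠ i) : k = i + 1 ∨ k = i + 2 := by
  revert i k; decide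

lemma fin_three_exists_ne (i l : Fin 3) : ∃ k : Fin 3, k ≠ i ∧ l ≠ k := by
  revert i l; decide

lemma fin_three_add_one_ne (i : Fin 3) : i + 1 ≠ i + 2 := by
  revert i; decide

lemma cross_swap (p q x : E2) : cross q p x = -cross p q x := by
  unfold cross
  ring

/-- A second expression for `cross b c x`, expanded along the triangle `p q r`. -/
lemma cross_mul_cross (b c p q r x : E2) :
    cross b c x * cross p q r =
      cross b c p * cross q r x + cross b c q * cross r p x + cross b c r * cross p q x := by
  unfold cross
  ring

lemma bary_eq_sum (w : Fin 3 → E2) (k : Fin 3) {v : Fin 3 → E2} (hv : AffineIndependent ℝ v)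
    (x : E2) :
    bary w k x = bary v 0 x * bary w k (v 0) + bary v 1 x * bary w k (v 1) +
      bary v 2 x * bary w k (v 2) := by
  have h := cross_ne_zero hv
  have h1 := cross_mul_cross (w (k + 1)) (w (k + 2)) (v 0) (v 1) (v 2) x
  rw [← eq_div_iff h] at h1
  simp only [bary, fin_three_one_add_two, fin_three_two_add_two, fin_three_one_add_one,
    fin_three_two_add_one, zero_add, h1]
  field_simp

lemma bary_pos_of_mem_openSegment {v : Fin 3 → E2} (hv : AffineIndependent ℝ v) {i : Fin 3}
    {m : E2} (hm : m ∈ openSegment ℝ (v (i + 1)) (v (i + 2))) :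
    bary v i m = 0 ∧ ∀ k, k ≠ i → 0 < bary v k m := by
  rw [openSegment_eq_image_lineMap] at hm
  obtain ⟨t, ⟨h0, h1⟩, rfl⟩ := hm
  refine ⟨by rw [bary_lineMap, bary_add_one, bary_add_two]; ring, fun k hk => ?_⟩
  rw [bary_lineMap]
  rcases fin_three_eq_of_ne hk with rfl | rfl
  · rw [bary_self hv, bary_of_ne v (fin_three_add_one_ne i).symm]
    linarith
  · rw [bary_self hv, bary_of_ne v (fin_three_add_one_ne i)]
    linarith

lemma add_one_ne_add_two {v : Fin 3 → E2} (hv : AffineIndependent ℝ v) (i : Fin 3) :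
    v (i + 1) ≠ v (i + 2) :=
  fun h => fin_three_add_one_ne i (hv.injective h)

lemma exists_oppEdge_eq_segment (v : Fin 3 → E2) {i j : Fin 3} (h : i ≠ j) :
    ∃ k, segment ℝ (v i) (v j) = oppEdge v k ∧ i ≠ k ∧ j ≠ k := by
  have : ∃ k : Fin 3, i ≠ k ∧ j ≠ k ∧ ((i = k + 1 ∧ j = k + 2) ∨ (i = k + 2 ∧ j = k + 1)) := by
    revert i j; decide
  obtain ⟨k, h1, h2, ⟨hi, hj⟩ | ⟨hi, hj⟩⟩ := this
  · exact ⟨k, by rw [hi, hj]; rfl, h1, h2⟩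
  · exact ⟨k, by rw [hi, hj, segment_symm]; rfl, h1, h2⟩

lemma segment_eq_segment_imp {p q p' q' : E2} (hpq : p ≠ q)
    (h : segment ℝ p q = segment ℝ p' q') : (p' = p ∧ q' = q) ∨ (p' = q ∧ q' = p) := by
  have h1 : p' ∈ segment ℝ p q := h ▸ left_mem_segment ℝ p' q'
  have h2 : q' ∈ segment ℝ p q := h ▸ right_mem_segment ℝ p' q'
  have h3 : p ∈ segment ℝ p' q' := h ▸ left_mem_segment ℝ p q
  have h4 : q ∈ segment ℝ p' q' := h ▸ right_mem_segment ℝ p q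
  rw [segment_eq_image_lineMap] at h1 h2 h3 h4
  obtain ⟨s, hs, rfl⟩ := h1
  obtain ⟨t, ht, rfl⟩ := h2
  obtain ⟨a, ha, h3⟩ := h3
  obtain ⟨b, hb, h4⟩ := h4
  have hne : q - p ≠ 0 := sub_ne_zero.2 hpq.symm
  have e3 : ((1 - a) * s + a * t) • (q - p) = 0 := by
    rw [AffineMap.lineMap_apply_module', AffineMap.lineMap_apply_module',
      AffineMap.lineMap_apply_module'] at h3
    rw [← sub_eq_zero] at h3
    rw [← h3]
    module
  have e4 : ((1 - b) * s + b * t - 1) • (q - p) = 0 := by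
    rw [AffineMap.lineMap_apply_module', AffineMap.lineMap_apply_module',
      AffineMap.lineMap_apply_module'] at h4
    rw [← sub_eq_zero] at h4
    rw [← h4]
    module
  have e3 := (smul_eq_zero.1 e3).resolve_right hne
  have e4 := (smul_eq_zero.1 e4).resolve_right hne
  obtain ⟨hs0, hs1⟩ := hs
  obtain ⟨ht0, ht1⟩ := ht
  obtain ⟨ha0, ha1⟩ := ha
  obtain ⟨hb0, hb1⟩ := hb
  rcases le_total s t with hst | hst
  · have hs : s = 0 := by nlinarith
    have ht : t = 1 := by nlinarith
    left
    simp [hs, ht]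
  · have hs : s = 1 := by nlinarith
    have ht : t = 0 := by nlinarith
    right
    simp [hs, ht]

lemma cross_oppEdge_ne_zero {v : Fin 3 → E2} (hv : AffineIndependent ℝ v) (i : Fin 3) :
    cross (v (i + 1)) (v (i + 2)) (v i) ≠ 0 := by
  rw [cross_rotate]
  exact cross_ne_zero hv

/-- Two triangles which intersect exactly in a common edge lie on opposite sides of it. -/
lemma cross_mul_cross_neg {v w : Fin 3 → E2} (hv : AffineIndependent ℝ v)
    (hw : AffineIndependent ℝ w) {i j : Fin 3} (h1 : oppEdge v i = tri v ∩ tri w)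
    (h2 : oppEdge w j = tri v ∩ tri w) :
    cross (v (i + 1)) (v (i + 2)) (v i) * cross (v (i + 1)) (v (i + 2)) (w j) < 0 := by
  have hseg := segment_eq_segment_imp (add_one_ne_add_two hv i) (h1.trans h2.symm)
  have hv0 := cross_oppEdge_ne_zero hv i
  have hw0 : cross (v (i + 1)) (v (i + 2)) (w j) ≠ 0 := by
    have := cross_oppEdge_ne_zero hw j
    rcases hseg with ⟨e1, e2⟩ | ⟨e1, e2⟩
    · rwa [e1, e2] at this
    · rw [e1, e2, cross_swap] at this
      exact neg_ne_zero.1 this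
  by_contra hcon
  have hpos : 0 < cross (v (i + 1)) (v (i + 2)) (v i) * cross (v (i + 1)) (v (i + 2)) (w j) :=
    lt_of_le_of_ne (not_lt.1 hcon) (mul_ne_zero hv0 hw0).symm
  set m : E2 := AffineMap.lineMap (v (i + 1)) (v (i + 2)) (1 / 2 : ℝ) with hm
  have hmo : m ∈ openSegment ℝ (v (i + 1)) (v (i + 2)) := by
    rw [openSegment_eq_image_lineMap]
    exact ⟨1 / 2, by norm_num, rfl⟩
  obtain ⟨hm0, hmk⟩ := bary_pos_of_mem_openSegment hv hmo
  have hmw : m ∈ tri w := by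
    have : m ∈ oppEdge v i := openSegment_subset_segment ℝ _ _ hmo
    rw [h1] at this
    exact this.2
  have hwi : 0 < bary v i (w j) := by
    rw [bary, ← cross_rotate v i]
    rcases mul_pos_iff.1 hpos with h | h
    · exact div_pos h.2 h.1
    · exact div_pos_of_neg_of_neg h.2 h.1
  have hev : ∀ᶠ ε in nhdsWithin (0 : ℝ) (Set.Ioi 0), ∀ k, k ≠ i →
      0 < bary v k (AffineMap.lineMap m (w j) ε) := by
    rw [Filter.eventually_all]
    intro k
    by_cases hk : k = i
    · simp [hk]
    · have hc : Continuous fun ε : ℝ => bary v k (AffineMap.lineMap m (w j) ε) := by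
        simp only [bary_lineMap]
        fun_prop
      have : ∀ᶠ ε in nhds (0 : ℝ), 0 < bary v k (AffineMap.lineMap m (w j) ε) :=
        hc.continuousAt.eventually_const_lt (by simpa using hmk k hk)
      exact (this.filter_mono nhdsWithin_le_nhds).mono fun ε h _ => h
  have hev2 : ∀ᶠ ε in nhdsWithin (0 : ℝ) (Set.Ioi 0), ε ∈ Set.Ioo (0 : ℝ) 1 :=
    Ioo_mem_nhdsGT one_pos
  obtain ⟨ε, hε, hε0, hε1⟩ := (hev.and hev2).exists
  have hx : AffineMap.lineMap m (w j) ε ∈ oppEdge v i := by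
    rw [h1]
    constructor
    · rw [mem_tri_iff hv]
      intro k
      by_cases hk : k = i
      · subst hk
        rw [bary_lineMap, hm0]
        nlinarith
      · exact (hε k hk).le
    · exact (convex_tri w).lineMap_mem hmw (vertex_mem_tri w j) ⟨hε0.le, hε1.le⟩
  have h0 := ((mem_oppEdge_iff hv).1 hx).2
  rw [bary_lineMap, hm0] at h0
  nlinarith

lemma mem_interior_tri_iff {v : Fin 3 → E2} (hv : AffineIndependent ℝ v) {x : E2} :
    x ∈ interior (tri v) ↔ ∀ k, 0 < bary v k x := by
  constructor
  · intro hx k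
    refine lt_of_le_of_ne ((mem_tri_iff hv).1 (interior_subset hx) k) fun h0 => ?_
    have hc : Continuous fun ε : ℝ => (AffineMap.lineMap x (v k) (-ε) : E2) := by
      simp only [AffineMap.lineMap_apply_module']
      fun_prop
    have hev : ∀ᶠ ε in nhds (0 : ℝ), (AffineMap.lineMap x (v k) (-ε) : E2) ∈ interior (tri v) :=
      hc.continuousAt.eventually_mem (isOpen_interior.mem_nhds (by simpa using hx))
    obtain ⟨ε, hε, hε0⟩ := ((hev.filter_mono nhdsWithin_le_nhds).and
      (self_mem_nhdsWithin (s := Set.Ioi (0 : ℝ)))).exists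
    have := (mem_tri_iff hv).1 (interior_subset hε) k
    rw [bary_lineMap, ← h0, bary_self hv] at this
    have : 0 < ε := hε0
    linarith
  · intro h
    have ho : IsOpen {y | ∀ k, 0 < bary v k y} := by
      rw [Set.ofPred_forall]
      exact isOpen_iInter_of_finite fun k => isOpen_lt continuous_const (continuous_bary v k)
    refine interior_maximal (fun y hy => ?_) ho h
    exact (mem_tri_iff hv).2 fun k => (hy k).le

section Triangulation

variable {T : Fin 3 → E2} {𝒦 : Finset (Fin 3 → E2)}

lemma IsRegularTriangulationOf.tri_subset {S : Set E2} (h : IsRegularTriangulationOf 𝒦 S)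
    {K : Fin 3 → E2} (hK : K ∈ 𝒦) : tri K ⊆ S := by
  rw [← h.2.1]
  exact Set.subset_biUnion_of_mem (u := fun K => tri K) hK

lemma IsRegularTriangulationOf.inter_eq_oppEdge {S : Set E2}
    (h : IsRegularTriangulationOf 𝒦 S) {K K' : Fin 3 → E2} (hK : K ∈ 𝒦) (hK' : K' ∈ 𝒦)
    (hne : K ≠ K') {x y : E2} (hx : x ∈ tri K ∩ tri K') (hy : y ∈ tri K ∩ tri K')
    (hxy : x ≠ y) : ∃ i, oppEdge K i = tri K ∩ tri K' := by
  rcases h.2.2 K hK K' hK' hne with h | ⟨l, h⟩ | ⟨l, l', hl, h⟩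
  · rw [h] at hx
    exact hx.elim
  · rw [h] at hx hy
    exact absurd (hx.trans hy.symm) hxy
  · obtain ⟨k, hk, -⟩ := exists_oppEdge_eq_segment K hl
    exact ⟨k, by rw [h, hk]⟩

lemma IsRegularTriangulationOf.exists_common_edge {S : Set E2}
    (h : IsRegularTriangulationOf 𝒦 S) {K K' : Fin 3 → E2} (hK : K ∈ 𝒦) (hK' : K' ∈ 𝒦)
    (hne : K ≠ K') (hpos : 0 < μH[1] (tri K ∩ tri K')) :
    ∃ i j, oppEdge K i = tri K ∩ tri K' ∧ oppEdge K' j = tri K ∩ tri K' := by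
  have hnull : NullSingletonClass (μH[1] : Measure E2) :=
    Measure.nullSingletonClass_hausdorff E2 one_pos
  have hnt : (tri K ∩ tri K').Nontrivial := by
    by_contra hcon
    rw [Set.not_nontrivial_iff] at hcon
    rw [hcon.measure_zero] at hpos
    exact lt_irrefl _ hpos
  obtain ⟨x, hx, y, hy, hxy⟩ := hnt
  obtain ⟨i, hi⟩ := h.inter_eq_oppEdge hK hK' hne hx hy hxy
  rw [Set.inter_comm] at hx hy
  obtain ⟨j, hj⟩ := h.inter_eq_oppEdge hK' hK hne.symm hx hy hxy
  exact ⟨i, j, hi, by rw [hj, Set.inter_comm]⟩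

lemma oppEdge_injective {v : Fin 3 → E2} (hv : AffineIndependent ℝ v) {i j : Fin 3}
    (h : oppEdge v i = oppEdge v j) : i = j := by
  by_contra hij
  have h1 : v j ∈ oppEdge v i := by
    rw [mem_oppEdge_iff hv]
    exact ⟨vertex_mem_tri v j, bary_of_ne v (Ne.symm hij)⟩
  rw [h, mem_oppEdge_iff hv, bary_self hv] at h1
  exact one_ne_zero h1.2

lemma IsRegularTriangulationOf.exists_neighbour
    (h : IsRegularTriangulationOf 𝒦 (tri T)) {K : Fin 3 → E2} (hK : K ∈ 𝒦) {i : Fin 3}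
    (hi : ¬ oppEdge K i ⊆ frontier (tri T)) :
    ∃ K' ∈ 𝒦, K ≠ K' ∧ oppEdge K i = tri K ∩ tri K' := by
  have hKi := h.1 K hK
  have hcl : IsClosed (tri T) := (isCompact_tri T).isClosed
  obtain ⟨x, hx, hxf⟩ := Set.not_subset.1 hi
  have hxi : x ∈ interior (tri T) := by
    by_contra hcon
    rw [hcl.frontier_eq] at hxf
    exact hxf ⟨h.tri_subset hK (oppEdge_subset_tri K i hx), hcon⟩
  obtain ⟨m, hmT, hmo⟩ := mem_closure_iff.1 (segment_subset_closure_openSegment hx) _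
    isOpen_interior hxi
  obtain ⟨hm0, hmk⟩ := bary_pos_of_mem_openSegment hKi hmo
  have hmK : m ∈ tri K := oppEdge_subset_tri K i (openSegment_subset_segment ℝ _ _ hmo)
  set C : Set E2 := ⋃ K' ∈ 𝒦.filter (fun K' => m ∉ tri K'), tri K' with hC
  have hCc : IsClosed C :=
    Set.Finite.isClosed_biUnion (Finset.finite_toSet _) fun K' _ => (isCompact_tri K').isClosed
  have hmC : m ∉ C := by
    simp only [hC, Set.mem_iUnion, Finset.mem_filter, not_exists]
    rintro K' ⟨-, h1⟩ h2
    exact h1 h2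
  have hc : Continuous fun ε : ℝ => (AffineMap.lineMap m (K i) (-ε) : E2) := by
    simp only [AffineMap.lineMap_apply_module']
    fun_prop
  have hev : ∀ᶠ ε in nhds (0 : ℝ),
      (AffineMap.lineMap m (K i) (-ε) : E2) ∈ interior (tri T) ∩ Cᶜ :=
    hc.continuousAt.eventually_mem ((isOpen_interior.inter hCc.isOpen_compl).mem_nhds
      (by simpa using ⟨hmT, hmC⟩))
  obtain ⟨ε, ⟨hεT, hεC⟩, hε0⟩ := ((hev.filter_mono nhdsWithin_le_nhds).and
    (self_mem_nhdsWithin (s := Set.Ioi (0 : ℝ)))).exists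
  have hε0 : 0 < ε := hε0
  have hyT := interior_subset hεT
  rw [← h.2.1] at hyT
  simp only [Set.mem_iUnion] at hyT
  obtain ⟨K', hK', hy⟩ := hyT
  have hmK' : m ∈ tri K' := by
    by_contra hcon
    apply hεC
    simp only [hC, Set.mem_iUnion, Finset.mem_filter]
    exact ⟨K', ⟨hK', hcon⟩, hy⟩
  have hne : K ≠ K' := by
    rintro rfl
    have := (mem_tri_iff hKi).1 hy i
    rw [bary_lineMap, hm0, bary_self hKi] at this
    linarith
  refine ⟨K', hK', hne, ?_⟩
  rcases h.2.2 K hK K' hK' hne with h | ⟨l, h⟩ | ⟨l, l', hl, h⟩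
  · exact absurd (h ▸ (⟨hmK, hmK'⟩ : m ∈ tri K ∩ tri K')) (Set.notMem_empty m)
  · exfalso
    have : m ∈ tri K ∩ tri K' := ⟨hmK, hmK'⟩
    rw [h, Set.mem_singleton_iff] at this
    obtain ⟨k, hk1, hk2⟩ := fin_three_exists_ne i l
    have h1 := hmk k hk1
    rw [this, bary_of_ne K hk2] at h1
    exact lt_irrefl _ h1
  · obtain ⟨k, hk, -⟩ := exists_oppEdge_eq_segment K hl
    have : m ∈ tri K ∩ tri K' := ⟨hmK, hmK'⟩
    rw [h, hk, mem_oppEdge_iff hKi] at this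
    have hki : k = i := by
      by_contra hcon
      have := hmk k hcon
      linarith
    rw [h, hk, hki]

lemma IsRegularTriangulationOf.neighbour_unique {S : Set E2}
    (h : IsRegularTriangulationOf 𝒦 S) {K K' K'' : Fin 3 → E2} (hK : K ∈ 𝒦) (hK' : K' ∈ 𝒦)
    (hK'' : K'' ∈ 𝒦) (h1 : K ≠ K') (h2 : K ≠ K'') {i : Fin 3}
    (hi' : oppEdge K i = tri K ∩ tri K') (hi'' : oppEdge K i = tri K ∩ tri K'') : K' = K'' := by
  by_contra hne
  have hKi := h.1 K hK
  have hd := add_one_ne_add_two hKi i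
  have hp : K (i + 1) ∈ oppEdge K i := left_mem_segment ℝ _ _
  have hq : K (i + 2) ∈ oppEdge K i := right_mem_segment ℝ _ _
  obtain ⟨j', hj'⟩ := h.inter_eq_oppEdge hK' hK h1.symm
    (Set.inter_comm _ _ ▸ hi' ▸ hp) (Set.inter_comm _ _ ▸ hi' ▸ hq) hd
  obtain ⟨j'', hj''⟩ := h.inter_eq_oppEdge hK'' hK h2.symm
    (Set.inter_comm _ _ ▸ hi'' ▸ hp) (Set.inter_comm _ _ ▸ hi'' ▸ hq) hd
  rw [Set.inter_comm] at hj' hj''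
  have hp' : K (i + 1) ∈ tri K' ∩ tri K'' := ⟨(hi' ▸ hp).2, (hi'' ▸ hp).2⟩
  have hq' : K (i + 2) ∈ tri K' ∩ tri K'' := ⟨(hi' ▸ hq).2, (hi'' ▸ hq).2⟩
  obtain ⟨l, hl⟩ := h.inter_eq_oppEdge hK' hK'' hne hp' hq' hd
  have hseg' := segment_eq_segment_imp hd (hi'.trans hj'.symm)
  have hlj : l = j' := by
    have a1 := (mem_oppEdge_iff (h.1 K' hK')).1 (hl ▸ hp')
    have a2 := (mem_oppEdge_iff (h.1 K' hK')).1 (hl ▸ hq')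
    by_contra hcon
    rcases hseg' with ⟨e1, e2⟩ | ⟨e1, e2⟩ <;> rcases fin_three_eq_of_ne hcon with rfl | rfl
    · rw [← e1, bary_self (h.1 K' hK')] at a1; exact one_ne_zero a1.2
    · rw [← e2, bary_self (h.1 K' hK')] at a2; exact one_ne_zero a2.2
    · rw [← e1, bary_self (h.1 K' hK')] at a2; exact one_ne_zero a2.2
    · rw [← e2, bary_self (h.1 K' hK')] at a1; exact one_ne_zero a1.2
  subst hlj
  have s1 := cross_mul_cross_neg hKi (h.1 K' hK') hi' hj'
  have s2 := cross_mul_cross_neg hKi (h.1 K'' hK'') hi'' hj''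
  have s3 := cross_mul_cross_neg (h.1 K' hK') (h.1 K'' hK'') hl
    (hj''.trans (hi''.symm.trans (hi'.trans (hj'.symm.trans hl))))
  have s4 : cross (K (i + 1)) (K (i + 2)) (K' l) * cross (K (i + 1)) (K (i + 2)) (K'' j'') < 0 := by
    rcases hseg' with ⟨e1, e2⟩ | ⟨e1, e2⟩
    · rwa [e1, e2] at s3
    · rwa [e1, e2, cross_swap (K (i + 1)), cross_swap (K (i + 1)), neg_mul_neg] at s3
  nlinarith [mul_pos_of_neg_of_neg s1 s2, sq_nonneg (cross (K (i + 1)) (K (i + 2)) (K i))]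

end Triangulation

/-- The length of the edge of `v` opposite to the vertex `i` times its oriented distance
from `P`. -/
def edgeWeight (v : Fin 3 → E2) (i : Fin 3) (P : E2) : ℝ :=
  |cross (v 0) (v 1) (v 2)| * bary v i P

lemma edgeWeight_eq {v : Fin 3 → E2} (i : Fin 3) (P : E2) :
    edgeWeight v i P = SignType.sign (cross (v (i + 1)) (v (i + 2)) (v i)) *
      cross (v (i + 1)) (v (i + 2)) P := by
  rw [edgeWeight, bary, cross_rotate]
  set D := cross (v 0) (v 1) (v 2)
  rcases lt_trichotomy D 0 with h | h | h
  · rw [abs_of_neg h, sign_neg h]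
    have := h.ne
    simp
    field_simp
  · simp [h]
  · rw [abs_of_pos h, sign_pos h]
    have := h.ne'
    simp
    field_simp

lemma edgeWeight_neg {v w : Fin 3 → E2} (hv : AffineIndependent ℝ v)
    (hw : AffineIndependent ℝ w) {i j : Fin 3} (h1 : oppEdge v i = tri v ∩ tri w)
    (h2 : oppEdge w j = tri v ∩ tri w) (P : E2) : edgeWeight w j P = -edgeWeight v i P := by
  have hneg := cross_mul_cross_neg hv hw h1 h2
  rw [edgeWeight_eq, edgeWeight_eq]
  have key : SignType.sign (cross (v (i + 1)) (v (i + 2)) (w j)) =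
      -SignType.sign (cross (v (i + 1)) (v (i + 2)) (v i)) := by
    rcases mul_neg_iff.1 hneg with h | h
    · rw [sign_pos h.1, sign_neg h.2]
    · rw [sign_neg h.1, sign_pos h.2]; rfl
  rcases segment_eq_segment_imp (add_one_ne_add_two hv i) (h1.trans h2.symm) with
    ⟨e1, e2⟩ | ⟨e1, e2⟩
  · rw [e1, e2, key]
    simp
  · rw [e1, e2, cross_swap (v (i + 1)), cross_swap (v (i + 1)), Left.sign_neg, key]
    simp

lemma abs_cross_le (p q x : E2) : |cross p q x| ≤ ‖q - p‖ * ‖x - p‖ := by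
  refine abs_le_of_sq_le_sq ?_ (by positivity)
  rw [mul_pow, EuclideanSpace.norm_sq_eq, EuclideanSpace.norm_sq_eq]
  simp only [Fin.sum_univ_two, Real.norm_eq_abs, sq_abs, PiLp.sub_apply, cross]
  nlinarith [sq_nonneg ((q 0 - p 0) * (x 0 - p 0) + (q 1 - p 1) * (x 1 - p 1))]

lemma abs_edgeWeight_le (v : Fin 3 → E2) (i : Fin 3) (P : E2) :
    |edgeWeight v i P| ≤ ‖v (i + 2) - v (i + 1)‖ * ‖P - v (i + 1)‖ := by
  refine le_trans ?_ (abs_cross_le _ _ _)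
  rw [edgeWeight_eq, abs_mul]
  refine mul_le_of_le_one_left (abs_nonneg _) ?_
  rcases SignType.trichotomy (SignType.sign (cross (v (i + 1)) (v (i + 2)) (v i)))
    with h | h | h <;> simp [h]

lemma edgeWeight_nonneg_of_bary_eq_zero {T v : Fin 3 → E2} (hT : AffineIndependent ℝ T)
    (hv : AffineIndependent ℝ v) (hsub : tri v ⊆ tri T) {i k : Fin 3}
    (h1 : bary T k (v (i + 1)) = 0) (h2 : bary T k (v (i + 2)) = 0) {P : E2} (hP : P ∈ tri T) :
    0 ≤ edgeWeight v i P := by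
  have hs : ∀ x, bary T k x = bary v i x * bary T k (v i) := by
    intro x
    have := bary_eq_sum T k hv x
    fin_cases i <;> simp [fin_three_one_add_two, fin_three_two_add_two, fin_three_one_add_one,
      fin_three_two_add_one] at * <;> simp_all
  have h3 : 0 < bary T k (v i) := by
    refine lt_of_le_of_ne ((mem_tri_iff hT).1 (hsub (vertex_mem_tri v i)) k) fun h0 => ?_
    have := hs (T k)
    rw [← h0, bary_self hT] at this
    simp at this
  have h4 := hs P ▸ (mem_tri_iff hT).1 hP k
  exact mul_nonneg (abs_nonneg _) (nonneg_of_mul_nonneg_left h4 h3)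

lemma edgeWeight_mul_norm {T v : Fin 3 → E2} (hT : AffineIndependent ℝ T)
    (hv : AffineIndependent ℝ v) (hsub : tri v ⊆ tri T) {i k : Fin 3}
    (h1 : bary T k (v (i + 1)) = 0) (h2 : bary T k (v (i + 2)) = 0) :
    edgeWeight v i (T k) * ‖T (k + 2) - T (k + 1)‖ =
      |cross (T 0) (T 1) (T 2)| * ‖v (i + 2) - v (i + 1)‖ := by
  have hnn := edgeWeight_nonneg_of_bary_eq_zero hT hv hsub h1 h2 (vertex_mem_tri T k)
  have hp := (mem_oppEdge_iff hT).2 ⟨hsub (vertex_mem_tri v (i + 1)), h1⟩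
  have hq := (mem_oppEdge_iff hT).2 ⟨hsub (vertex_mem_tri v (i + 2)), h2⟩
  rw [oppEdge, segment_eq_image_lineMap] at hp hq
  obtain ⟨s, -, hp⟩ := hp
  obtain ⟨t, -, hq⟩ := hq
  have hc := cross_oppEdge_ne_zero hv i
  have habs : edgeWeight v i (T k) = |cross (v (i + 1)) (v (i + 2)) (T k)| := by
    rw [← abs_of_nonneg hnn, edgeWeight_eq, abs_mul]
    rcases lt_or_gt_of_ne hc with h | h
    · simp [sign_neg h]
    · simp [sign_pos h]
  rw [habs, ← cross_rotate T k, ← hp, ← hq]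
  have e1 : cross (AffineMap.lineMap (T (k + 1)) (T (k + 2)) s)
      (AffineMap.lineMap (T (k + 1)) (T (k + 2)) t) (T k) =
      (t - s) * cross (T (k + 1)) (T (k + 2)) (T k) := by
    simp [cross, AffineMap.lineMap_apply]
    ring
  have e2 : (AffineMap.lineMap (T (k + 1)) (T (k + 2)) t : E2) -
      AffineMap.lineMap (T (k + 1)) (T (k + 2)) s = (t - s) • (T (k + 2) - T (k + 1)) := by
    simp only [AffineMap.lineMap_apply_module']
    module
  rw [e1, e2, abs_mul, norm_smul, Real.norm_eq_abs]
  ring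

/-- An edge contained in the boundary of `T` lies on one of the edges of `T`. -/
lemma exists_bary_eq_zero_of_subset_frontier {T v : Fin 3 → E2} (hT : AffineIndependent ℝ T)
    (hsub : tri v ⊆ tri T) {i : Fin 3} (hi : oppEdge v i ⊆ frontier (tri T)) :
    ∃ k, bary T k (v (i + 1)) = 0 ∧ bary T k (v (i + 2)) = 0 := by
  set m : E2 := AffineMap.lineMap (v (i + 1)) (v (i + 2)) (1 / 2 : ℝ) with hm
  have hmo : m ∈ oppEdge v i := by
    rw [oppEdge, segment_eq_image_lineMap]
    exact ⟨1 / 2, by norm_num, rfl⟩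
  have hmf := (hi hmo).2
  rw [mem_interior_tri_iff hT] at hmf
  push Not at hmf
  obtain ⟨k, hk⟩ := hmf
  have h1 := (mem_tri_iff hT).1 (hsub (vertex_mem_tri v (i + 1))) k
  have h2 := (mem_tri_iff hT).1 (hsub (vertex_mem_tri v (i + 2))) k
  rw [hm, bary_lineMap] at hk
  exact ⟨k, by linarith, by linarith⟩

lemma oppEdge_subset_frontier {T v : Fin 3 → E2} (hT : AffineIndependent ℝ T)
    (hsub : tri v ⊆ tri T) {i k : Fin 3}
    (h1 : bary T k (v (i + 1)) = 0) (h2 : bary T k (v (i + 2)) = 0) :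
    oppEdge v i ⊆ frontier (tri T) := by
  intro x hx
  refine ⟨subset_closure (hsub (oppEdge_subset_tri v i hx)), fun hxi => ?_⟩
  have := (mem_interior_tri_iff hT).1 hxi k
  rw [oppEdge, segment_eq_image_lineMap] at hx
  obtain ⟨t, -, rfl⟩ := hx
  rw [bary_lineMap, h1, h2] at this
  simp at this

lemma oppEdge_inter_tri {T v : Fin 3 → E2} (hT : AffineIndependent ℝ T)
    (hv : AffineIndependent ℝ v) (hsub : tri v ⊆ tri T) (k : Fin 3) :
    (∃ i, bary T k (v (i + 1)) = 0 ∧ bary T k (v (i + 2)) = 0 ∧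
      oppEdge T k ∩ tri v ⊆ oppEdge v i) ∨ (oppEdge T k ∩ tri v).Subsingleton := by
  have hnn : ∀ j, 0 ≤ bary T k (v j) := fun j =>
    (mem_tri_iff hT).1 (hsub (vertex_mem_tri v j)) k
  have hz : ∀ x ∈ oppEdge T k ∩ tri v, ∀ j, bary v j x = 0 ∨ bary T k (v j) = 0 := by
    rintro x ⟨hx1, hx2⟩ j
    have h0 := ((mem_oppEdge_iff hT).1 hx1).2
    have hx2 := (mem_tri_iff hv).1 hx2
    rw [bary_eq_sum T k hv] at h0
    have a0 := mul_nonneg (hx2 0) (hnn 0)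
    have a1 := mul_nonneg (hx2 1) (hnn 1)
    have a2 := mul_nonneg (hx2 2) (hnn 2)
    rw [← mul_eq_zero]
    fin_cases j <;> simp only [Fin.zero_eta, Fin.mk_one, Fin.reduceFinMk] <;> linarith
  have hpos : ∃ j, bary T k (v j) ≠ 0 := by
    by_contra hcon
    push Not at hcon
    have := bary_eq_sum T k hv (T k)
    rw [bary_self hT, hcon, hcon, hcon] at this
    simp at this
  obtain ⟨i, hi⟩ := hpos
  by_cases h : bary T k (v (i + 1)) = 0 ∧ bary T k (v (i + 2)) = 0
  · left
    refine ⟨i, h.1, h.2, fun x hx => ?_⟩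
    exact (mem_oppEdge_iff hv).2 ⟨hx.2, (hz x hx i).resolve_right hi⟩
  · right
    have hj : ∃ j, j ≠ i ∧ bary T k (v j) ≠ 0 := by
      by_contra hcon
      push Not at hcon
      exact h ⟨hcon _ (by simp), hcon _ (by simp)⟩
    obtain ⟨j, hji, hj⟩ := hj
    have hl : ∃ l : Fin 3, ∀ m, m = l ∨ m = i ∨ m = j := by
      clear * - hji
      revert i j; decide
    obtain ⟨l, hl⟩ := hl
    have hx : ∀ x ∈ oppEdge T k ∩ tri v, x = v l := by
      intro x hx
      have b : ∀ m, m ≠ l → bary v m x = 0 := by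
        intro m hm
        rcases hl m with h | rfl | rfl
        · exact absurd h hm
        · exact (hz x hx _).resolve_right hi
        · exact (hz x hx _).resolve_right hj
      have hsum := sum_bary hv x
      have hrec := sum_bary_smul hv x
      conv_lhs => rw [← hrec]
      clear * - b hsum
      fin_cases l
      · have b1 := b 1 (by decide)
        have b2 := b 2 (by decide)
        have b0 : bary v 0 x = 1 := by linarith
        simp [b0, b1, b2]
      · have b1 := b 0 (by decide)
        have b2 := b 2 (by decide)
        have b0 : bary v 1 x = 1 := by linarith
        simp [b0, b1, b2]
      · have b1 := b 0 (by decide)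
        have b2 := b 1 (by decide)
        have b0 : bary v 2 x = 1 := by linarith
        simp [b0, b1, b2]
    intro x h1 y h2
    rw [hx x h1, hx y h2]

/-- The mean value of `g` over the edge of `v` opposite to the vertex `i`. -/
def edgeMean (v : Fin 3 → E2) (i : Fin 3) (g : E2 → ℝ) : ℝ :=
  ∫ t in (0 : ℝ)..1, g (AffineMap.lineMap (v (i + 1)) (v (i + 2)) t)

/-- The length of the edge of `v` opposite to the vertex `i`. -/
def edgeLength (v : Fin 3 → E2) (i : Fin 3) : ℝ := ‖v (i + 2) - v (i + 1)‖

lemma setIntegral_oppEdge (v : Fin 3 → E2) (i : Fin 3) (g : E2 → ℝ) :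
    ∫ x in oppEdge v i, g x ∂μH[1] = edgeLength v i * edgeMean v i g :=
  setIntegral_segment _ _ _

lemma edgeLength_pos {v : Fin 3 → E2} (hv : AffineIndependent ℝ v) (i : Fin 3) :
    0 < edgeLength v i :=
  norm_pos_iff.2 (sub_ne_zero.2 (add_one_ne_add_two hv i).symm)

lemma diam_oppEdge (v : Fin 3 → E2) (i : Fin 3) :
    Metric.diam (oppEdge v i) = edgeLength v i := by
  rw [oppEdge, ← convexHull_pair, convexHull_diam, Metric.diam_pair, dist_comm, dist_eq_norm]
  rfl

lemma edgeMean_nonneg (v : Fin 3 → E2) (i : Fin 3) {g : E2 → ℝ} (hg : ∀ x, 0 ≤ g x) :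
    0 ≤ edgeMean v i g :=
  intervalIntegral.integral_nonneg zero_le_one fun _ _ => hg _

lemma edgeMean_congr {v w : Fin 3 → E2} (hv : AffineIndependent ℝ v) {i j : Fin 3}
    (h : oppEdge v i = oppEdge w j) (g : E2 → ℝ) : edgeMean w j g = edgeMean v i g := by
  have h1 := setIntegral_oppEdge v i g
  rw [h, setIntegral_oppEdge, ← diam_oppEdge v, h, diam_oppEdge] at h1
  refine mul_left_cancel₀ ?_ h1
  rw [← diam_oppEdge, ← h, diam_oppEdge]
  exact (edgeLength_pos hv i).ne'

lemma continuous_comp_lineMap {g : E2 → ℝ} (hg : Continuous g) (p q : E2) :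
    Continuous fun t : ℝ => g (AffineMap.lineMap p q t) := by
  simp only [AffineMap.lineMap_apply_module']
  fun_prop

lemma norm_sub_le_diam {v : Fin 3 → E2} {x y : E2} (hx : x ∈ tri v) (hy : y ∈ tri v) :
    ‖x - y‖ ≤ Metric.diam (tri v) := by
  rw [← dist_eq_norm]
  exact Metric.dist_le_diam_of_mem (isCompact_tri v).isBounded hx hy

lemma fderiv_sq_apply {f : E2 → ℝ} (hf : ContDiff ℝ 1 f) (x y : E2) :
    fderiv ℝ (fun x => f x ^ 2) x y = 2 * f x * fderiv ℝ f x y := by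
  have h := ((hf.differentiable one_ne_zero).differentiableAt (x := x)).hasFDerivAt.pow 2
  rw [h.fderiv]
  simp

lemma setIntegral_sq_le {v : Fin 3 → E2} {f : E2 → ℝ} (hf : ContDiff ℝ 1 f) {P : E2} {D : ℝ}
    (hD : ∀ x ∈ tri v, ‖x - P‖ ≤ D) :
    ∫ x in tri v, (2 * f x ^ 2 + fderiv ℝ (fun x => f x ^ 2) x (x - P)) ≤
      3 * (∫ x in tri v, f x ^ 2) + D ^ 2 * ∫ x in tri v, ‖fderiv ℝ f x‖ ^ 2 := by
  have hf' : Continuous (fderiv ℝ f) := hf.continuous_fderiv one_ne_zero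
  have hfc := hf.continuous
  rw [← integral_const_mul, ← integral_const_mul, ← integral_add
    (integrableOn_tri v (by fun_prop)) (integrableOn_tri v (by fun_prop))]
  simp only [fderiv_sq_apply hf]
  refine setIntegral_mono_on (integrableOn_tri v (by fun_prop)) (integrableOn_tri v (by fun_prop))
    (isCompact_tri v).measurableSet fun x hx => ?_
  have h1 : |fderiv ℝ f x (x - P)| ≤ ‖fderiv ℝ f x‖ * D :=
    ((fderiv ℝ f x).le_opNorm _).trans (by gcongr; exact hD x hx)
  have h2 := pow_le_pow_left₀ (abs_nonneg _) h1 2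
  rw [sq_abs] at h2
  nlinarith [sq_nonneg (f x - fderiv ℝ f x (x - P))]

/-- The trace inequality for a single shape regular triangle. -/
lemma edgeLength_sq_mul_edgeMean_le {γ : ℝ} (hγ : 0 < γ) {v : Fin 3 → E2}
    (hv : AffineIndependent ℝ v) (hs : ShapeReg γ v) {D : ℝ} (hD : Metric.diam (tri v) ≤ D)
    {f : E2 → ℝ} (hf : ContDiff ℝ 1 f) (i : Fin 3) :
    edgeLength v i ^ 2 * edgeMean v i (fun x => f x ^ 2) ≤
      γ / 2 * (3 * (∫ x in tri v, f x ^ 2) + D ^ 2 * ∫ x in tri v, ‖fderiv ℝ f x‖ ^ 2) := by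
  have h1 := setIntegral_tri_vertex hv i (hf.pow 2)
  have h2 := setIntegral_sq_le hf (P := v i) (D := D) fun x hx =>
    (norm_sub_le_diam hx (vertex_mem_tri v i)).trans hD
  rw [h1] at h2
  have h3 : edgeLength v i ^ 2 ≤ γ / 2 * |cross (v 0) (v 1) (v 2)| := by
    have h4 : edgeLength v i ≤ Metric.diam (tri v) :=
      norm_sub_le_diam (vertex_mem_tri v _) (vertex_mem_tri v _)
    have h5 := pow_le_pow_left₀ (norm_nonneg _) h4 2
    have h6 := volume_tri hv
    unfold ShapeReg at hs
    rw [← h6]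
    calc _ ≤ _ := h5
      _ ≤ _ := hs
      _ = _ := by ring
  calc _ ≤ γ / 2 * |cross (v 0) (v 1) (v 2)| * edgeMean v i (fun x => f x ^ 2) := by
        gcongr
        exact edgeMean_nonneg v i fun x => sq_nonneg _
    _ ≤ _ := by
        rw [mul_assoc]
        gcongr
        exact h2

/-- `K` and `K'` are distinct triangles sharing an edge not contained in the boundary of `T`. -/
def ShareInteriorEdge (T K K' : Fin 3 → E2) : Prop :=
  K ≠ K' ∧ 0 < μH[1] (tri K ∩ tri K') ∧ ¬ tri K ∩ tri K' ⊆ frontier (tri T)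

lemma ShareInteriorEdge.symm {T K K' : Fin 3 → E2} (h : ShareInteriorEdge T K K') :
    ShareInteriorEdge T K' K := by
  unfold ShareInteriorEdge at *
  rw [Set.inter_comm]
  exact ⟨h.1.symm, h.2⟩

lemma sum_interior_edges {T : Fin 3 → E2} {𝒦 : Finset (Fin 3 → E2)}
    (h : IsRegularTriangulationOf 𝒦 (tri T)) {K : Fin 3 → E2} (hK : K ∈ 𝒦) (Φ : Fin 3 → ℝ) :
    ∑ i, (if oppEdge K i ⊆ frontier (tri T) then 0 else Φ i) =
      ∑ K' ∈ 𝒦, if ShareInteriorEdge T K K' then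
        ∑ i, (if oppEdge K i = tri K ∩ tri K' then Φ i else 0) else 0 := by
  have hsw : ∀ K' ∈ 𝒦, (if ShareInteriorEdge T K K' then
        ∑ i, (if oppEdge K i = tri K ∩ tri K' then Φ i else 0) else 0) =
      ∑ i, (if ShareInteriorEdge T K K' ∧ oppEdge K i = tri K ∩ tri K' then Φ i else 0) := by
    intro K' _
    by_cases hs : ShareInteriorEdge T K K' <;> simp [hs]
  rw [Finset.sum_congr rfl hsw, Finset.sum_comm]
  refine Finset.sum_congr rfl fun i _ => ?_
  by_cases hi : oppEdge K i ⊆ frontier (tri T)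
  · rw [if_pos hi, Finset.sum_eq_zero]
    rintro K' -
    rw [if_neg]
    rintro ⟨hs, he⟩
    exact hs.2.2 (he ▸ hi)
  · rw [if_neg hi]
    obtain ⟨K', hK', hne, he⟩ := h.exists_neighbour hK hi
    rw [Finset.sum_eq_single K']
    · rw [if_pos]
      refine ⟨⟨hne, ?_, he ▸ hi⟩, he⟩
      rw [← he]
      exact hausdorffMeasure_segment_pos (add_one_ne_add_two (h.1 K hK) i)
    · intro K'' hK'' hne'
      rw [if_neg]
      rintro ⟨hs, he'⟩
      exact hne' (h.neighbour_unique hK hK'' hK' hs.1 hne he' he)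
    · exact fun hn => absurd hK' hn

/-- The contribution of an interior edge shared by `v` and `w`. -/
lemma neg_edge_flux_le {v w : Fin 3 → E2} (hv : AffineIndependent ℝ v)
    (hw : AffineIndependent ℝ w) {i j : Fin 3} (h1 : oppEdge v i = tri v ∩ tri w)
    (h2 : oppEdge w j = tri v ∩ tri w) {P : E2} {D : ℝ} (hP : ‖P - v (i + 1)‖ ≤ D)
    {f g : E2 → ℝ} (hf : Continuous f) (hg : Continuous g) :
    (-(edgeWeight v i P * edgeMean v i (fun x => f x ^ 2)) -
        edgeLength v i ^ 2 * edgeMean v i (fun x => f x ^ 2)) +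
      (-(edgeWeight w j P * edgeMean w j (fun x => g x ^ 2)) -
        edgeLength w j ^ 2 * edgeMean w j (fun x => g x ^ 2)) ≤
      1 / 2 * D ^ 2 * edgeMean v i (fun x => (f x - g x) ^ 2) := by
  have he := h1.trans h2.symm
  have hl : edgeLength w j = edgeLength v i := by rw [← diam_oppEdge, ← he, diam_oppEdge]
  rw [edgeWeight_neg hv hw h1 h2, edgeMean_congr hv he, hl]
  have hW : |edgeWeight v i P| ≤ edgeLength v i * D :=
    (abs_edgeWeight_le v i P).trans (by rw [edgeLength]; gcongr)
  set W := edgeWeight v i P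
  set L := edgeLength v i
  have hc : ∀ {u : E2 → ℝ}, Continuous u → IntervalIntegrable
      (fun t : ℝ => u (AffineMap.lineMap (v (i + 1)) (v (i + 2)) t)) volume 0 1 :=
    fun hu => (continuous_comp_lineMap hu _ _).intervalIntegrable _ _
  have hlin : ∀ {u : E2 → ℝ} (_ : Continuous u) (a : ℝ), a * edgeMean v i u =
      edgeMean v i (fun x => a * u x) := fun _ a => by
    simp only [edgeMean, intervalIntegral.integral_const_mul]
  have key : edgeMean v i (fun x => (-W - L ^ 2) * f x ^ 2 + (W - L ^ 2) * g x ^ 2) ≤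
      edgeMean v i (fun x => 1 / 2 * D ^ 2 * (f x - g x) ^ 2) := by
    refine intervalIntegral.integral_mono_on zero_le_one
      (hc (u := fun x => (-W - L ^ 2) * f x ^ 2 + (W - L ^ 2) * g x ^ 2) (by fun_prop))
      (hc (u := fun x => 1 / 2 * D ^ 2 * (f x - g x) ^ 2) (by fun_prop)) fun t _ => ?_
    set a := f (AffineMap.lineMap (v (i + 1)) (v (i + 2)) t)
    set b := g (AffineMap.lineMap (v (i + 1)) (v (i + 2)) t)
    have hL : 0 ≤ L := norm_nonneg _
    have h3 : -W * (a - b) * (a + b) ≤ L * D * |a - b| * |a + b| := by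
      calc -W * (a - b) * (a + b) ≤ |-W * (a - b) * (a + b)| := le_abs_self _
        _ = |W| * |a - b| * |a + b| := by rw [abs_mul, abs_mul, abs_neg]
        _ ≤ _ := by gcongr
    nlinarith [sq_nonneg (D * |a - b| - L * |a + b|), sq_abs (a - b), sq_abs (a + b),
      sq_nonneg (L * (a - b))]
  rw [← hlin (by fun_prop)] at key
  refine le_trans (le_of_eq ?_) key
  have hadd : edgeMean v i (fun x => (-W - L ^ 2) * f x ^ 2 + (W - L ^ 2) * g x ^ 2) =
      edgeMean v i (fun x => (-W - L ^ 2) * f x ^ 2) +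
        edgeMean v i (fun x => (W - L ^ 2) * g x ^ 2) := by
    unfold edgeMean
    exact intervalIntegral.integral_add (hc (u := fun x => (-W - L ^ 2) * f x ^ 2) (by fun_prop))
      (hc (u := fun x => (W - L ^ 2) * g x ^ 2) (by fun_prop))
  rw [hadd, ← hlin (by fun_prop), ← hlin (by fun_prop)]
  ring

lemma jumpTerm_eq {T K K' : Fin 3 → E2} (hK : AffineIndependent ℝ K)
    (hs : ShareInteriorEdge T K K') {i : Fin 3} (hi : oppEdge K i = tri K ∩ tri K')
    (f : (Fin 3 → E2) → E2 → ℝ) :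
    jumpTerm T K K' f = edgeMean K i (fun x => (f K x - f K' x) ^ 2) := by
  unfold jumpTerm
  rw [if_pos ⟨hs.1, hs.2.1, hs.2.2⟩, ← hi, diam_oppEdge, setIntegral_oppEdge,
    inv_mul_cancel_left₀]
  exact (edgeLength_pos hK i).ne'

lemma jumpTerm_eq_zero {T K K' : Fin 3 → E2} (hs : ¬ ShareInteriorEdge T K K')
    (f : (Fin 3 → E2) → E2 → ℝ) : jumpTerm T K K' f = 0 := by
  unfold jumpTerm
  unfold ShareInteriorEdge at hs
  rw [if_neg hs]

/-- The fluxes through the interior edges are controlled by the jumps and the edge norms. -/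
lemma neg_sum_interior_flux_le {T : Fin 3 → E2} {𝒦 : Finset (Fin 3 → E2)}
    (h : IsRegularTriangulationOf 𝒦 (tri T)) {P : E2} {D : ℝ}
    (hP : ∀ x ∈ tri T, ‖P - x‖ ≤ D) {f : (Fin 3 → E2) → E2 → ℝ}
    (hf : ∀ K ∈ 𝒦, Continuous (f K)) :
    ∑ K ∈ 𝒦, ∑ i, (if oppEdge K i ⊆ frontier (tri T) then 0 else
      (-(edgeWeight K i P * edgeMean K i (fun x => f K x ^ 2)) -
        edgeLength K i ^ 2 * edgeMean K i (fun x => f K x ^ 2))) ≤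
      1 / 2 * D ^ 2 * ((1 / 2) * ∑ K ∈ 𝒦, ∑ K' ∈ 𝒦, jumpTerm T K K' f) := by
  rw [Finset.sum_congr rfl fun K hK => sum_interior_edges h hK _]
  set Q : (Fin 3 → E2) → (Fin 3 → E2) → ℝ := fun K K' => if ShareInteriorEdge T K K' then
      ∑ i, (if oppEdge K i = tri K ∩ tri K' then
        (-(edgeWeight K i P * edgeMean K i (fun x => f K x ^ 2)) -
          edgeLength K i ^ 2 * edgeMean K i (fun x => f K x ^ 2)) else 0) else 0 with hQ
  change ∑ K ∈ 𝒦, ∑ K' ∈ 𝒦, Q K K' ≤ _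
  have hpair : ∀ K ∈ 𝒦, ∀ K' ∈ 𝒦, Q K K' + Q K' K ≤ 1 / 2 * D ^ 2 * jumpTerm T K K' f := by
    intro K hK K' hK'
    by_cases hs : ShareInteriorEdge T K K'
    · obtain ⟨i, j, hi, hj⟩ := h.exists_common_edge hK hK' hs.1 hs.2.1
      have e1 : ∀ k, oppEdge K k = tri K ∩ tri K' ↔ k = i := fun k =>
        ⟨fun hk => oppEdge_injective (h.1 K hK) (hk.trans hi.symm), fun hk => hk ▸ hi⟩
      have e2 : ∀ k, oppEdge K' k = tri K' ∩ tri K ↔ k = j := fun k =>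
        ⟨fun hk => oppEdge_injective (h.1 K' hK') (hk.trans ((Set.inter_comm _ _).trans hj.symm)),
          fun hk => hk ▸ hj.trans (Set.inter_comm _ _)⟩
      simp only [hQ, if_pos hs, if_pos hs.symm, e1, e2, Finset.sum_ite_eq', Finset.mem_univ,
        if_true]
      rw [jumpTerm_eq (h.1 K hK) hs hi]
      exact neg_edge_flux_le (h.1 K hK) (h.1 K' hK') hi hj
        (hP _ (h.tri_subset hK (vertex_mem_tri K _))) (hf K hK) (hf K' hK')
    · have hs' : ¬ ShareInteriorEdge T K' K := fun hc => hs hc.symm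
      simp only [hQ, if_neg hs, if_neg hs', jumpTerm_eq_zero hs]
      simp
  have hsum := Finset.sum_le_sum fun K hK => Finset.sum_le_sum (hpair K hK)
  simp only [Finset.sum_add_distrib] at hsum
  rw [Finset.sum_comm (f := fun K K' => Q K' K)] at hsum
  simp only [← Finset.mul_sum] at hsum
  linarith

/-- The divergence theorem on a single triangle, with the boundary flux bounded below by the
trace on an edge of `T`. -/
lemma trace_add_interior_flux_le {T K : Fin 3 → E2} (hT : AffineIndependent ℝ T)
    (hK : AffineIndependent ℝ K) (hsub : tri K ⊆ tri T) (k : Fin 3) {D : ℝ}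
    (hD : Metric.diam (tri T) ≤ D) {f : E2 → ℝ} (hf : ContDiff ℝ 1 f) :
    |cross (T 0) (T 1) (T 2)| / edgeLength T k *
          (∫ x in oppEdge T k ∩ tri K, f x ^ 2 ∂μH[1]) +
        ∑ i, (if oppEdge K i ⊆ frontier (tri T) then 0 else
          edgeWeight K i (T k) * edgeMean K i (fun x => f x ^ 2)) ≤
      3 * (∫ x in tri K, f x ^ 2) + D ^ 2 * ∫ x in tri K, ‖fderiv ℝ f x‖ ^ 2 := by
  have h1 := setIntegral_sq_le (v := K) hf (P := T k) (D := D) fun x hx =>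
    (norm_sub_le_diam (hsub hx) (vertex_mem_tri T k)).trans hD
  rw [setIntegral_tri_point hK (T k) (hf.pow 2)] at h1
  refine le_trans ?_ h1
  have hl := edgeLength_pos hT k
  set W : Fin 3 → ℝ := fun i => edgeWeight K i (T k) * edgeMean K i (fun x => f x ^ 2) with hW
  change _ + ∑ i, (if oppEdge K i ⊆ frontier (tri T) then 0 else W i) ≤ ∑ i, W i
  have hsplit : ∑ i, W i = ∑ i, (if oppEdge K i ⊆ frontier (tri T) then W i else 0) +
      ∑ i, (if oppEdge K i ⊆ frontier (tri T) then 0 else W i) := by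
    rw [← Finset.sum_add_distrib]
    refine Finset.sum_congr rfl fun i _ => ?_
    split_ifs <;> simp
  rw [hsplit]
  gcongr
  have hm : ∀ i, 0 ≤ edgeMean K i (fun x => f x ^ 2) := fun i =>
    edgeMean_nonneg K i fun x => sq_nonneg _
  have hnn : ∀ i ∈ Finset.univ, 0 ≤ (if oppEdge K i ⊆ frontier (tri T) then W i else 0) := by
    intro i _
    split_ifs with hi
    · obtain ⟨l, hl1, hl2⟩ := exists_bary_eq_zero_of_subset_frontier hT hsub hi
      exact mul_nonneg (edgeWeight_nonneg_of_bary_eq_zero hT hK hsub hl1 hl2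
        (vertex_mem_tri T k)) (hm i)
    · exact le_rfl
  rcases oppEdge_inter_tri hT hK hsub k with ⟨i, hi1, hi2, hi⟩ | hss
  · refine le_trans ?_ (Finset.single_le_sum hnn (Finset.mem_univ i))
    rw [if_pos (oppEdge_subset_frontier hT hsub hi1 hi2)]
    have hw := edgeWeight_mul_norm hT hK hsub hi1 hi2
    change _ * edgeLength T k = _ * edgeLength K i at hw
    have hmono : ∫ x in oppEdge T k ∩ tri K, f x ^ 2 ∂μH[1] ≤
        ∫ x in oppEdge K i, f x ^ 2 ∂μH[1] :=
      setIntegral_mono_set (integrableOn_segment (hf.continuous.pow 2))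
        (Filter.Eventually.of_forall fun x => sq_nonneg _) hi.eventuallyLE
    rw [setIntegral_oppEdge] at hmono
    calc _ ≤ |cross (T 0) (T 1) (T 2)| / edgeLength T k *
          (edgeLength K i * edgeMean K i (fun x => f x ^ 2)) := by gcongr
      _ = W i := by
        simp only [hW]
        rw [← mul_assoc, div_mul_eq_mul_div, ← hw, mul_div_cancel_right₀ _ hl.ne']
  · have hnull : NullSingletonClass (μH[1] : Measure E2) :=
      Measure.nullSingletonClass_hausdorff E2 one_pos
    rw [Measure.restrict_eq_zero.2 (hss.measure_zero _)]
    simpa using Finset.sum_nonneg hnn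

lemma scaled_trace_le {γ : ℝ} (hγ : 0 < γ) {T : Fin 3 → E2} (hT : AffineIndependent ℝ T)
    {𝒦 : Finset (Fin 3 → E2)} (h : IsRegularTriangulationOf 𝒦 (tri T))
    (hs : ∀ K ∈ 𝒦, ShapeReg γ K) (k : Fin 3) {f : (Fin 3 → E2) → E2 → ℝ}
    (hf : ∀ K ∈ 𝒦, ContDiff ℝ 1 (f K)) {D : ℝ} (hD : Metric.diam (tri T) ≤ D) :
    |cross (T 0) (T 1) (T 2)| / edgeLength T k *
        (∑ K ∈ 𝒦, ∫ x in oppEdge T k ∩ tri K, f K x ^ 2 ∂μH[1]) ≤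
      (1 + 3 * γ / 2) * (3 * (∑ K ∈ 𝒦, ∫ x in tri K, f K x ^ 2) +
        D ^ 2 * ∑ K ∈ 𝒦, ∫ x in tri K, ‖fderiv ℝ (f K) x‖ ^ 2) +
      1 / 2 * D ^ 2 * ((1 / 2) * ∑ K ∈ 𝒦, ∑ K' ∈ 𝒦, jumpTerm T K K' f) := by
  have h1 := Finset.sum_le_sum fun K hK =>
    trace_add_interior_flux_le hT (h.1 K hK) (h.tri_subset hK) k hD (hf K hK)
  have h2 := neg_sum_interior_flux_le h (P := T k) (D := D)
    (fun x hx => (norm_sub_le_diam (vertex_mem_tri T k) hx).trans hD)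
    fun K hK => (hf K hK).continuous
  have h3 : ∑ K ∈ 𝒦, ∑ i, (if oppEdge K i ⊆ frontier (tri T) then 0 else
      edgeLength K i ^ 2 * edgeMean K i (fun x => f K x ^ 2)) ≤
      ∑ K ∈ 𝒦, 3 * (γ / 2 * (3 * (∫ x in tri K, f K x ^ 2) +
        D ^ 2 * ∫ x in tri K, ‖fderiv ℝ (f K) x‖ ^ 2)) := by
    refine Finset.sum_le_sum fun K hK => ?_
    have hKD : Metric.diam (tri K) ≤ D :=
      (Metric.diam_mono (h.tri_subset hK) (isCompact_tri T).isBounded).trans hD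
    have hi := fun i => edgeLength_sq_mul_edgeMean_le hγ (h.1 K hK) (hs K hK) hKD (hf K hK) i
    refine (Finset.sum_le_card_nsmul _ _ (γ / 2 * (3 * (∫ x in tri K, f K x ^ 2) +
      D ^ 2 * ∫ x in tri K, ‖fderiv ℝ (f K) x‖ ^ 2)) fun i _ => ?_).trans_eq ?_
    · split_ifs
      · exact le_trans (mul_nonneg (sq_nonneg _)
          (edgeMean_nonneg K i fun x => sq_nonneg _)) (hi i)
      · exact hi i
    · simp
  have h4 : ∀ K ∈ 𝒦, ∑ i, (if oppEdge K i ⊆ frontier (tri T) then 0 else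
      (-(edgeWeight K i (T k) * edgeMean K i (fun x => f K x ^ 2)) -
        edgeLength K i ^ 2 * edgeMean K i (fun x => f K x ^ 2))) =
      -∑ i, (if oppEdge K i ⊆ frontier (tri T) then 0 else
        edgeWeight K i (T k) * edgeMean K i (fun x => f K x ^ 2)) -
      ∑ i, (if oppEdge K i ⊆ frontier (tri T) then 0 else
        edgeLength K i ^ 2 * edgeMean K i (fun x => f K x ^ 2)) := by
    intro K _
    rw [← Finset.sum_neg_distrib, ← Finset.sum_sub_distrib]
    refine Finset.sum_congr rfl fun i _ => ?_
    split_ifs <;> simp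
  rw [Finset.sum_congr rfl h4] at h2
  simp only [Finset.sum_add_distrib, Finset.sum_sub_distrib, Finset.sum_neg_distrib,
    ← Finset.mul_sum] at h1 h2 h3
  linarith

lemma jumpTerm_nonneg (T K K' : Fin 3 → E2) (f : (Fin 3 → E2) → E2 → ℝ) :
    0 ≤ jumpTerm T K K' f := by
  unfold jumpTerm
  split_ifs
  · exact mul_nonneg (inv_nonneg.2 Metric.diam_nonneg) (integral_nonneg fun x => sq_nonneg _)
  · exact le_rfl

lemma sqrt_add_le_sqrt_add_sqrt {a b : ℝ} (ha : 0 ≤ a) (hb : 0 ≤ b) : √(a + b) ≤ √a + √b := by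
  refine Real.sqrt_le_iff.2 ⟨by positivity, ?_⟩
  nlinarith [Real.sq_sqrt ha, Real.sq_sqrt hb, mul_nonneg (Real.sqrt_nonneg a) (Real.sqrt_nonneg b)]

lemma sqrt_le_of_le_mul {M h S A B J : ℝ} (hM : 0 ≤ M) (hh : 0 < h) (hA : 0 ≤ A) (hB : 0 ≤ B)
    (hJ : 0 ≤ J) (hS : S ≤ M * (h⁻¹ * A + h * B + h * J)) :
    √S ≤ √M * ((√h)⁻¹ * √A + √h * √B + √h * √J) := by
  rw [← Real.sqrt_inv, ← Real.sqrt_mul (by positivity), ← Real.sqrt_mul (by positivity),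
    ← Real.sqrt_mul (by positivity)]
  refine (Real.sqrt_le_sqrt hS).trans ?_
  rw [Real.sqrt_mul hM]
  gcongr
  have h1 : 0 ≤ h⁻¹ * A := by positivity
  have h2 : 0 ≤ h * B := by positivity
  have h3 : 0 ≤ h * J := by positivity
  linarith [sqrt_add_le_sqrt_add_sqrt (add_nonneg h1 h2) h3, sqrt_add_le_sqrt_add_sqrt h1 h2]

lemma trace_constant_bound {γ h D l S A B J : ℝ} (hγ : 0 < γ) (hh : 0 < h) (hl : 0 < l)
    (hlD : l ≤ D) (hD : D ^ 2 ≤ γ * h ^ 2) (hS : 0 ≤ S) (hA : 0 ≤ A) (hB : 0 ≤ B) (hJ : 0 ≤ J)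
    (H : 2 * h ^ 2 / l * S ≤ (1 + 3 * γ / 2) * (3 * A + D ^ 2 * B) + 1 / 2 * D ^ 2 * J) :
    S ≤ √γ / 2 * ((1 + 3 * γ / 2) * (3 + γ) + γ) * (h⁻¹ * A + h * B + h * J) := by
  have hDh : D ≤ √γ * h := by
    rw [← Real.sqrt_sq hh.le, ← Real.sqrt_mul hγ.le]
    exact Real.le_sqrt_of_sq_le hD
  set c := 1 + 3 * γ / 2 with hc
  have hc0 : 0 < c := by positivity
  have h1 : 2 * h ^ 2 * S ≤ √γ * h * (c * (3 * A + γ * h ^ 2 * B) + 1 / 2 * (γ * h ^ 2) * J) := by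
    calc 2 * h ^ 2 * S = l * (2 * h ^ 2 / l * S) := by field_simp
      _ ≤ √γ * h * (c * (3 * A + D ^ 2 * B) + 1 / 2 * D ^ 2 * J) := by
        gcongr
        exact hlD.trans hDh
      _ ≤ _ := by gcongr
  have h2 : c * (3 * A + γ * h ^ 2 * B) + 1 / 2 * (γ * h ^ 2) * J ≤
      (c * (3 + γ) + γ) * (A + h ^ 2 * B + h ^ 2 * J) := by
    have hB' : 0 ≤ h ^ 2 * B := by positivity
    have hJ' : 0 ≤ h ^ 2 * J := by positivity
    have e1 : 0 ≤ (c * γ + γ) * A := by positivity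
    have e2 : 0 ≤ (c * 3 + γ) * (h ^ 2 * B) := by positivity
    have e3 : 0 ≤ (c * (3 + γ) + γ / 2) * (h ^ 2 * J) := by positivity
    linarith
  have h3 : h⁻¹ * A + h * B + h * J = h⁻¹ * (A + h ^ 2 * B + h ^ 2 * J) := by
    field_simp
  refine le_of_mul_le_mul_left (h1.trans ?_) (by positivity : 0 < 2 * h ^ 2)
  calc _ ≤ √γ * h * ((c * (3 + γ) + γ) * (A + h ^ 2 * B + h ^ 2 * J)) := by gcongr
    _ = _ := by rw [h3]; field_simp

/-- **Discrete trace inequality**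
(Proposition 2.3 in Gallistl, *Morley FEM for the eigenvalues of the
biharmonic operator*).

Let `T ∈ T_ℓ` be a triangle (with vertices `Tv`), let `𝒦` be a regular
triangulation of `T` and let `G = conv{Tv i, Tv j}` be an edge of `T`.
Any function `f` which is piecewise smooth with respect to `𝒦` (given by
its smooth pieces `f K`, `K ∈ 𝒦`) satisfies
`‖f‖_{L²(G)} ≲ h_T^{-1/2}‖f‖_{L²(T)} + h_T^{1/2}‖D_{NC(𝒦)}f‖_{L²(T)}
  + h_T^{1/2}(Σ_{F ∈ 𝔽(𝒦), F ⊄ ∂T} h_F⁻¹‖[f]_F‖²_{L²(F)})^{1/2}`.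
The constant depends only on `Ω` and the initial triangulation `T₀`
(through the shape-regularity parameter `γ` of the admissible class `𝕋`);
in particular the ratio `h_T/h_F` need not be uniformly bounded: the
constant is uniform in the triangulation `𝒦`.
(Each interior edge `F = K ∩ K'` is visited by the two ordered pairs
`(K,K')` and `(K',K)`, whence the factor `1/2` in the jump term.) -/
theorem discrete_trace_inequality (γ : ℝ) (hγ : 0 < γ) :
    ∃ C : ℝ, 0 < C ∧
      ∀ Tv : Fin 3 → E2, AffineIndependent ℝ Tv → ShapeReg γ Tv →
      ∀ 𝒦 : Finset (Fin 3 → E2), IsRegularTriangulationOf 𝒦 (tri Tv) →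
        (∀ K ∈ 𝒦, ShapeReg γ K) →
      ∀ i j : Fin 3, i ≠ j →
      ∀ f : (Fin 3 → E2) → E2 → ℝ, (∀ K ∈ 𝒦, ContDiff ℝ (⊤ : ℕ∞) (f K)) →
        Real.sqrt (∑ K ∈ 𝒦,
            ∫ x in segment ℝ (Tv i) (Tv j) ∩ tri K, (f K x) ^ 2 ∂μH[1])
          ≤ C * ((Real.sqrt (hT Tv))⁻¹ *
                Real.sqrt (∑ K ∈ 𝒦, ∫ x in tri K, (f K x) ^ 2)
              + Real.sqrt (hT Tv) *
                Real.sqrt (∑ K ∈ 𝒦, ∫ x in tri K, ‖fderiv ℝ (f K) x‖ ^ 2)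
              + Real.sqrt (hT Tv) *
                Real.sqrt ((1 / 2) * ∑ K ∈ 𝒦, ∑ K' ∈ 𝒦, jumpTerm Tv K K' f)) := by
  refine ⟨√(√γ / 2 * ((1 + 3 * γ / 2) * (3 + γ) + γ)), Real.sqrt_pos.2 (by positivity),
    fun T hTa hTs 𝒦 h𝒦 hs i j hij f hf => ?_⟩
  obtain ⟨k, hk, -⟩ := exists_oppEdge_eq_segment T hij
  rw [hk]
  have hcr := abs_pos.2 (cross_ne_zero hTa)
  have hvol := volume_tri hTa
  have hh : 0 < hT T := Real.sqrt_pos.2 (by linarith)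
  have hsq : hT T ^ 2 = (volume (tri T)).toReal := Real.sq_sqrt (by linarith)
  have key := scaled_trace_le hγ hTa h𝒦 hs k
    (fun K hK => (hf K hK).of_le (by exact_mod_cast le_top)) le_rfl
  rw [← hvol, ← hsq] at key
  have hA : 0 ≤ ∑ K ∈ 𝒦, ∫ x in tri K, f K x ^ 2 :=
    Finset.sum_nonneg fun K _ => integral_nonneg fun x => sq_nonneg _
  have hB : 0 ≤ ∑ K ∈ 𝒦, ∫ x in tri K, ‖fderiv ℝ (f K) x‖ ^ 2 :=
    Finset.sum_nonneg fun K _ => integral_nonneg fun x => sq_nonneg _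
  have hJ : 0 ≤ (1 / 2) * ∑ K ∈ 𝒦, ∑ K' ∈ 𝒦, jumpTerm T K K' f :=
    mul_nonneg (by norm_num) (Finset.sum_nonneg fun K _ => Finset.sum_nonneg fun K' _ =>
      jumpTerm_nonneg T K K' f)
  unfold ShapeReg at hTs
  exact sqrt_le_of_le_mul (by positivity) hh hA hB hJ
    (trace_constant_bound hγ hh (edgeLength_pos hTa k)
      (norm_sub_le_diam (vertex_mem_tri T _) (vertex_mem_tri T _)) (hsq ▸ hTs)
      (Finset.sum_nonneg fun K _ => integral_nonneg fun x => sq_nonneg _) hA hB hJ key)
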